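/- arXiv:1509.00888 — 2 statements merged into one kernel-verified Lean document; each statement's English description precedes it below -/
import Mathlib

section
/- Let d ≥ 1, M = (M_1,…,M_d) ∈ ℕ^d, and let F, G ∈ ℂ[X_1,…,X_d] be polynomials whose supports are contained in the box {n ∈ ℕ^d : n ≤ M componentwise}. Assume that every conjugate symmetric divisor of F in ℂ[X_1,…,X_d] is a constant (in particular F has no nontrivial conjugate symmetric factors and no monomial factors). If for every lattice point ω = (k_1/(2M_1+1),…,k_d/(2M_d+1)) with 0 ≤ k_j ≤ 2M_j the product F(e(ω))·conj(G(e(ω))) is real (equivalently, the phases of F and G agree modulo π at every such point), then G = c·F for some real constant c. -/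
open Complex MvPolynomial

noncomputable section

/-- A polynomial `P ∈ ℂ[X₁,…,X_d]` is conjugate symmetric if for some `θ ∈ ℝ` and
`k ∈ ℕ^d`, every exponent in the support of `P` is `≤ k` componentwise and
`coeff_m(P) = e^{iθ}·conj(coeff_{k−m}(P))` for all `m ≤ k`. -/
def ConjSymm {d : ℕ} (P : MvPolynomial (Fin d) ℂ) : Prop :=
  ∃ θ : ℝ, ∃ k : Fin d → ℕ,
    (∀ m ∈ P.support, ∀ i, m i ≤ k i) ∧
    ∀ m : Fin d →₀ ℕ, (∀ i, m i ≤ k i) →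
      P.coeff m = Complex.exp ((θ : ℂ) * Complex.I) *
        (starRingEnd ℂ) (P.coeff (Finsupp.equivFunOnFinite.symm fun i => k i - m i))

namespace Aux11

variable {d : ℕ}

/-- All exponents of `P` are `≤ k`. -/
def InBox (k : Fin d →₀ ℕ) (P : MvPolynomial (Fin d) ℂ) : Prop := ∀ m ∈ P.support, m ≤ k

/-- Conjugate reversal of `P` in the box `k`. -/
def rev (k : Fin d →₀ ℕ) (P : MvPolynomial (Fin d) ℂ) : MvPolynomial (Fin d) ℂ :=
  ∑ n ∈ Finset.Icc 0 k, monomial (k - n) ((starRingEnd ℂ) (P.coeff n))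

/-- The multidegree. -/
def dg (P : MvPolynomial (Fin d) ℂ) : Fin d →₀ ℕ :=
  Finsupp.equivFunOnFinite.symm fun i => P.degreeOf i

lemma dg_apply (P : MvPolynomial (Fin d) ℂ) (i : Fin d) : dg P i = P.degreeOf i := rfl

lemma inBox_iff {k : Fin d →₀ ℕ} {P : MvPolynomial (Fin d) ℂ} : InBox k P ↔ dg P ≤ k := by
  constructor
  · intro h i
    rw [dg_apply, degreeOf_le_iff]
    exact fun m hm => h m hm i
  · intro h m hm i
    exact (monomial_le_degreeOf i hm).trans (h i)

lemma dg_mul {P Q : MvPolynomial (Fin d) ℂ} (hP : P ≠ 0) (hQ : Q ≠ 0) :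
    dg (P * Q) = dg P + dg Q := by
  ext i
  simp [dg_apply, degreeOf_mul_eq hP hQ]

lemma coeff_rev (k : Fin d →₀ ℕ) (P : MvPolynomial (Fin d) ℂ) (n : Fin d →₀ ℕ) (hn : n ≤ k) :
    (rev k P).coeff n = (starRingEnd ℂ) (P.coeff (k - n)) := by
  rw [rev, coeff_sum, Finset.sum_eq_single (k - n)]
  · rw [tsub_tsub_cancel_of_le hn]; simp
  · intro m hm hne
    rw [Finset.mem_Icc] at hm
    rw [coeff_monomial, if_neg]
    rintro rfl
    exact hne (tsub_tsub_cancel_of_le hm.2).symm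
  · intro h
    exact absurd (Finset.mem_Icc.2 ⟨zero_le, tsub_le_self⟩) h

lemma inBox_rev (k : Fin d →₀ ℕ) (P : MvPolynomial (Fin d) ℂ) : InBox k (rev k P) := by
  intro m hm
  by_contra hlt
  rw [mem_support_iff, rev, coeff_sum] at hm
  apply hm
  refine Finset.sum_eq_zero fun n _ => ?_
  rw [coeff_monomial, if_neg]
  rintro rfl
  exact hlt tsub_le_self

lemma rev_rev {k : Fin d →₀ ℕ} {P : MvPolynomial (Fin d) ℂ} (hP : InBox k P) :
    rev k (rev k P) = P := by
  ext m
  by_cases hm : m ≤ k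
  · rw [coeff_rev _ _ _ hm, coeff_rev _ _ _ tsub_le_self, tsub_tsub_cancel_of_le hm]; simp
  · rw [notMem_support_iff.1 fun h => hm (hP m h),
      notMem_support_iff.1 fun h => hm (inBox_rev _ _ m h)]

lemma rev_zero (k : Fin d →₀ ℕ) : rev k (0 : MvPolynomial (Fin d) ℂ) = 0 := by
  simp [rev]

lemma rev_ne_zero {k : Fin d →₀ ℕ} {P : MvPolynomial (Fin d) ℂ} (hP : InBox k P) (h0 : P ≠ 0) :
    rev k P ≠ 0 := by
  intro h
  apply h0
  rw [← rev_rev hP, h, rev_zero]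

lemma rev_add (k : Fin d →₀ ℕ) (P Q : MvPolynomial (Fin d) ℂ) :
    rev k (P + Q) = rev k P + rev k Q := by
  simp [rev, Finset.sum_add_distrib]

lemma rev_sum (k : Fin d →₀ ℕ) {ι : Type*} (s : Finset ι) (f : ι → MvPolynomial (Fin d) ℂ) :
    rev k (∑ i ∈ s, f i) = ∑ i ∈ s, rev k (f i) :=
  map_sum (AddMonoidHom.mk' (rev k) (rev_add k)) f s

lemma rev_monomial (k m : Fin d →₀ ℕ) (hm : m ≤ k) (a : ℂ) :
    rev k (monomial m a) = monomial (k - m) ((starRingEnd ℂ) a) := by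
  rw [rev, Finset.sum_eq_single m]
  · simp
  · intro n _ hne
    rw [coeff_monomial, if_neg (Ne.symm hne)]; simp
  · intro h
    exact absurd (Finset.mem_Icc.2 ⟨zero_le, hm⟩) h

lemma rev_mul {k l : Fin d →₀ ℕ} {P Q : MvPolynomial (Fin d) ℂ} (hP : InBox k P)
    (hQ : InBox l Q) : rev (k + l) (P * Q) = rev k P * rev l Q := by
  conv_lhs => rw [P.as_sum, Q.as_sum]
  conv_rhs => rw [P.as_sum, Q.as_sum]
  simp only [Finset.sum_mul_sum, rev_sum]
  refine Finset.sum_congr rfl fun m hm => Finset.sum_congr rfl fun n hn => ?_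
  rw [monomial_mul, rev_monomial _ _ (add_le_add (hP m hm) (hQ n hn)),
    rev_monomial _ _ (hP m hm), rev_monomial _ _ (hQ n hn), monomial_mul, map_mul,
    tsub_add_tsub_comm (hP m hm) (hQ n hn)]

lemma eval_rev {k : Fin d →₀ ℕ} {P : MvPolynomial (Fin d) ℂ} (hP : InBox k P)
    (z : Fin d → ℂ) (hz : ∀ i, z i * (starRingEnd ℂ) (z i) = 1) :
    eval z (rev k P) = (∏ i, z i ^ k i) * (starRingEnd ℂ) (eval z P) := by
  conv_lhs => rw [P.as_sum]
  conv_rhs => rw [P.as_sum]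
  rw [rev_sum, map_sum, map_sum, map_sum, Finset.mul_sum]
  refine Finset.sum_congr rfl fun m hm => ?_
  rw [rev_monomial _ _ (hP m hm), eval_monomial, eval_monomial, map_mul,
    Finsupp.prod_fintype _ _ (by simp), Finsupp.prod_fintype _ _ (by simp), mul_left_comm,
    map_prod, ← Finset.prod_mul_distrib]
  congr 1
  refine Finset.prod_congr rfl fun i _ => ?_
  have h1 : k i = (k - m) i + m i := by
    have := hP m hm i
    simp only [Finsupp.tsub_apply]; omega
  rw [h1, pow_add, mul_assoc, map_pow, ← mul_pow, hz, one_pow, mul_one]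

lemma eq_C_of_dg {P : MvPolynomial (Fin d) ℂ} (h : dg P = 0) : P = C (P.coeff 0) := by
  have hb : InBox 0 P := inBox_iff.2 h.le
  ext m
  rw [coeff_C]
  split_ifs with hm
  · rw [hm]
  · refine notMem_support_iff.1 fun hs => hm ?_
    exact (le_antisymm (hb m hs) zero_le).symm

lemma conjSymm_X (i : Fin d) : ConjSymm (X i : MvPolynomial (Fin d) ℂ) := by
  classical
  refine ⟨0, fun j => if j = i then 2 else 0, ?_, ?_⟩
  · intro m hm j
    rw [support_X, Finset.mem_singleton] at hm
    subst hm
    rw [Finsupp.single_apply]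
    split_ifs <;> simp_all
  · intro m hm
    rw [coeff_X', coeff_X']
    have : (Finsupp.single i 1 = m) ↔ (Finsupp.single i 1 =
        (Finsupp.equivFunOnFinite.symm fun j => (if j = i then 2 else 0) - m j : Fin d →₀ ℕ)) := by
      rw [Finsupp.ext_iff, Finsupp.ext_iff]
      refine forall_congr' fun j => ?_
      have h := hm j
      simp only [Finsupp.single_apply, Finsupp.equivFunOnFinite_symm_apply_apply]
      by_cases hj : j = i
      · subst hj; simp at h ⊢; omega
      · simp [hj, Ne.symm hj] at h ⊢; omega
    simp only [this]
    split_ifs <;> simp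

lemma X_not_dvd {F : MvPolynomial (Fin d) ℂ}
    (hF : ∀ Q : MvPolynomial (Fin d) ℂ, Q ∣ F → ConjSymm Q → ∃ c : ℂ, Q = MvPolynomial.C c)
    (i : Fin d) : ¬ X i ∣ F := by
  intro h
  obtain ⟨c, hc⟩ := hF _ h (conjSymm_X i)
  have := congrArg (degreeOf i) hc
  simp [degreeOf_X] at this

lemma exists_support {D : MvPolynomial (Fin d) ℂ} {i : Fin d} (h : ¬ X i ∣ D) :
    ∃ m ∈ D.support, m i = 0 := by
  by_contra! hc
  apply h
  rw [D.as_sum]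
  refine Finset.dvd_sum fun m hm => ?_
  rw [X_dvd_monomial]
  exact Or.inr (hc m hm)

lemma conjSymm_of {D E : MvPolynomial (Fin d) ℂ} (hD0 : D ≠ 0) (hX : ∀ i, ¬ X i ∣ D)
    (hE : D = rev (dg D) D * E) : ConjSymm D := by
  have hbox : InBox (dg D) D := inBox_iff.2 le_rfl
  have hr0 := rev_ne_zero hbox hD0
  have hE0 : E ≠ 0 := by
    rintro rfl
    exact hD0 (by rw [hE, mul_zero])
  have hdr : dg (rev (dg D) D) = dg D := by
    refine le_antisymm (inBox_iff.1 (inBox_rev _ _)) fun i => ?_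
    obtain ⟨m, hm, hmi⟩ := exists_support (hX i)
    have hs : dg D - m ∈ (rev (dg D) D).support := by
      rw [mem_support_iff, coeff_rev _ _ _ tsub_le_self, tsub_tsub_cancel_of_le (hbox m hm)]
      simpa using mem_support_iff.1 hm
    have := monomial_le_degreeOf i hs
    simpa [hmi, dg_apply] using this
  have hdE : dg E = 0 := by
    have h := congrArg dg hE
    rw [dg_mul hr0 hE0, hdr] at h
    simpa using h
  obtain ⟨c, hc⟩ : ∃ c, E = C c := ⟨_, eq_C_of_dg hdE⟩
  have hcoef : ∀ m ≤ dg D, D.coeff m = c * (starRingEnd ℂ) (D.coeff (dg D - m)) := by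
    intro m hm
    have h := congrArg (coeff m) hE
    rw [hc, mul_comm, coeff_C_mul, coeff_rev _ _ _ hm] at h
    exact h
  have hcn : ‖c‖ = 1 := by
    obtain ⟨m, hm⟩ := support_nonempty.2 hD0
    have hmk := hbox m hm
    have h1 := hcoef m hmk
    rw [hcoef _ tsub_le_self, tsub_tsub_cancel_of_le hmk] at h1
    have h2 := congrArg norm h1
    simp only [norm_mul, RCLike.norm_conj] at h2
    have h3 : 0 < ‖D.coeff m‖ := norm_pos_iff.2 (mem_support_iff.1 hm)
    have h4 : ‖c‖ * ‖c‖ = 1 := by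
      have : ‖D.coeff m‖ * (‖c‖ * ‖c‖ - 1) = 0 := by linarith
      rcases mul_eq_zero.1 this with h | h <;> linarith
    nlinarith [norm_nonneg c]
  refine ⟨c.arg, fun i => dg D i, fun m hm i => hbox m hm i, fun m hm => ?_⟩
  have hce : Complex.exp ((c.arg : ℂ) * Complex.I) = c := by
    have := Complex.norm_mul_exp_arg_mul_I c
    rw [hcn] at this
    simpa using this
  rw [hce, hcoef m hm]
  congr 3
  ext i
  simp

lemma rev_dvd {k : Fin d →₀ ℕ} {D P : MvPolynomial (Fin d) ℂ} (hP : InBox k P) (hP0 : P ≠ 0)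
    (h : D ∣ P) : rev (dg D) D ∣ rev k P := by
  obtain ⟨A, rfl⟩ := h
  have hD0 := left_ne_zero_of_mul hP0
  have hA0 := right_ne_zero_of_mul hP0
  have hle := inBox_iff.1 hP
  rw [dg_mul hD0 hA0] at hle
  have hk : k = dg D + (k - dg D) :=
    (add_tsub_cancel_of_le (le_trans (le_add_of_nonneg_right zero_le) hle)).symm
  have hAb : InBox (k - dg D) A := by
    rw [inBox_iff]
    exact le_tsub_of_add_le_left hle
  rw [hk, rev_mul (inBox_iff.2 le_rfl) hAb]
  exact dvd_mul_right _ _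

lemma isRelPrime {M : Fin d →₀ ℕ} {F : MvPolynomial (Fin d) ℂ} (hb : InBox M F) (hF0 : F ≠ 0)
    (hF : ∀ Q : MvPolynomial (Fin d) ℂ, Q ∣ F → ConjSymm Q → ∃ c : ℂ, Q = MvPolynomial.C c) :
    IsRelPrime F (rev M F) := by
  classical
  letI : GCDMonoid (MvPolynomial (Fin d) ℂ) := UniqueFactorizationMonoid.toGCDMonoid _
  rw [← gcd_isUnit_iff_isRelPrime]
  set D := gcd F (rev M F) with hD
  have hDF : D ∣ F := gcd_dvd_left _ _
  have hDR : D ∣ rev M F := gcd_dvd_right _ _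
  have hD0 : D ≠ 0 := ne_zero_of_dvd_ne_zero hF0 hDF
  have h1 : rev (dg D) D ∣ rev M F := rev_dvd hb hF0 hDF
  have h2 : rev (dg D) D ∣ F := by
    have := rev_dvd (inBox_rev M F) (rev_ne_zero hb hF0) hDR
    rwa [rev_rev hb] at this
  obtain ⟨E, hE⟩ : rev (dg D) D ∣ D := dvd_gcd h2 h1
  obtain ⟨c, hc⟩ := hF D hDF
    (conjSymm_of hD0 (fun i hi => X_not_dvd hF i (hi.trans hDF)) hE)
  rw [hc]
  have : c ≠ 0 := by
    rintro rfl
    exact hD0 (by rw [hc, C_0])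
  exact (isUnit_iff_ne_zero.2 this).map C

lemma final {M : Fin d →₀ ℕ} {F G : MvPolynomial (Fin d) ℂ} (hb : InBox M F) (hG : InBox M G)
    (hF0 : F ≠ 0)
    (hF : ∀ Q : MvPolynomial (Fin d) ℂ, Q ∣ F → ConjSymm Q → ∃ c : ℂ, Q = MvPolynomial.C c)
    (h : F * rev M G = rev M F * G) : ∃ c : ℝ, G = C ((c : ℝ) : ℂ) * F := by
  have hdvd : F ∣ G := (isRelPrime hb hF0 hF).dvd_of_dvd_mul_left ⟨_, h.symm⟩
  obtain ⟨Q, rfl⟩ := hdvd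
  by_cases hQ0 : Q = 0
  · exact ⟨0, by simp [hQ0]⟩
  have hle := inBox_iff.1 hG
  rw [dg_mul hF0 hQ0] at hle
  have hM : M = (M - dg Q) + dg Q :=
    (tsub_add_cancel_of_le (le_trans (le_add_of_nonneg_left zero_le) hle)).symm
  have hFb : InBox (M - dg Q) F := inBox_iff.2 (le_tsub_of_add_le_right hle)
  have h1 : rev M (F * Q) = rev M F * Q := by
    apply mul_left_cancel₀ hF0
    rw [h]; ring
  have hone : InBox (dg Q) (1 : MvPolynomial (Fin d) ℂ) := by
    rw [inBox_iff]
    intro i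
    rw [dg_apply, degreeOf_one]
    exact zero_le
  have h2 : rev M (F * Q) = rev (M - dg Q) F * rev (dg Q) Q := by
    conv_lhs => rw [hM]
    exact rev_mul hFb (inBox_iff.2 le_rfl)
  have h3 : rev M F = rev (M - dg Q) F * rev (dg Q) 1 := by
    rw [← rev_mul hFb hone, ← hM, mul_one]
  rw [h2, h3, mul_assoc] at h1
  have h4 := mul_left_cancel₀ (rev_ne_zero hFb hF0) h1
  have hr1 : rev (dg Q) (1 : MvPolynomial (Fin d) ℂ) = monomial (dg Q) 1 := by
    have := rev_monomial (dg Q) 0 zero_le 1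
    simpa using this
  have hdQ : dg Q = 0 := by
    have h5 := inBox_iff.1 (inBox_rev (dg Q) Q)
    rw [h4, dg_mul (rev_ne_zero hone one_ne_zero) hQ0] at h5
    ext i
    have h6 := h5 i
    rw [Finsupp.add_apply, dg_apply (rev _ _), hr1, degreeOf_monomial_eq _ _ one_ne_zero] at h6
    simp only [Finsupp.coe_zero, Pi.zero_apply]
    omega
  have hQC := eq_C_of_dg hdQ
  have hconj : (starRingEnd ℂ) (Q.coeff 0) = Q.coeff 0 := by
    have h7 := congrArg (coeff 0) h4
    rw [hr1, hdQ, coeff_rev _ _ _ le_rfl] at h7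
    simpa using h7
  obtain ⟨r, hr⟩ := Complex.conj_eq_iff_real.1 hconj
  refine ⟨r, ?_⟩
  rw [← hr, ← hQC, mul_comm]

/-- The sample point. -/
def pt (n k : ℕ) : ℂ := Complex.exp (-(((2 * Real.pi : ℝ) : ℂ) * Complex.I) *
              ((k : ℂ) / (2 * (n : ℂ) + 1)))

lemma pt_inj (n : ℕ) : Function.Injective fun k : Fin (2 * n + 1) => pt n k := by
  have hp := (Complex.isPrimitiveRoot_exp (2 * n + 1) (by omega)).inv
  have hpt : ∀ k : ℕ, pt n k = ((Complex.exp (2 * Real.pi * Complex.I / (2 * n + 1 : ℕ)))⁻¹) ^ k := by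
    intro k
    rw [pt, ← Complex.exp_neg, ← Complex.exp_nat_mul]
    congr 1
    push_cast
    ring
  intro a b hab
  simp only [hpt] at hab
  exact Fin.ext (hp.pow_inj a.2 b.2 hab)

lemma pt_conj (n k : ℕ) : pt n k * (starRingEnd ℂ) (pt n k) = 1 := by
  rw [Complex.mul_conj, Complex.normSq_eq_norm_sq]
  have : pt n k = Complex.exp (((-(2 * Real.pi) * (k / (2 * n + 1)) : ℝ) : ℂ) * Complex.I) := by
    rw [pt]
    congr 1
    push_cast
    ring
  rw [this, Complex.norm_exp_ofReal_mul_I]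
  simp

end Aux11

theorem stmt11 (d : ℕ) (hd : 1 ≤ d) (M : Fin d → ℕ)
    (F G : MvPolynomial (Fin d) ℂ)
    (hFsupp : ∀ m ∈ F.support, ∀ i, m i ≤ M i)
    (hGsupp : ∀ m ∈ G.support, ∀ i, m i ≤ M i)
    (hF : ∀ Q : MvPolynomial (Fin d) ℂ, Q ∣ F → ConjSymm Q → ∃ c : ℂ, Q = MvPolynomial.C c)
    (hreal : ∀ k : (i : Fin d) → Fin (2 * M i + 1),
      ((MvPolynomial.eval
            (fun i : Fin d => Complex.exp (-(((2 * Real.pi : ℝ) : ℂ) * Complex.I) *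
              (((k i : ℕ) : ℂ) / (2 * ((M i : ℕ) : ℂ) + 1)))) F) *
        (starRingEnd ℂ)
          (MvPolynomial.eval
            (fun i : Fin d => Complex.exp (-(((2 * Real.pi : ℝ) : ℂ) * Complex.I) *
              (((k i : ℕ) : ℂ) / (2 * ((M i : ℕ) : ℂ) + 1)))) G)).im = 0) :
    ∃ c : ℝ, G = MvPolynomial.C ((c : ℝ) : ℂ) * F := by
  classical
  have hF0 : F ≠ 0 := by
    rintro rfl
    exact Aux11.X_not_dvd hF ⟨0, hd⟩ (dvd_zero _)
  set N : Fin d →₀ ℕ := Finsupp.equivFunOnFinite.symm M with hN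
  have hNi : ∀ i, N i = M i := fun i => rfl
  have hb : Aux11.InBox N F := fun m hm i => hFsupp m hm i
  have hG : Aux11.InBox N G := fun m hm i => hGsupp m hm i
  refine Aux11.final hb hG hF0 hF (sub_eq_zero.1 ?_)
  refine eq_zero_of_eval_zero_at_prod_finset _
    (fun i => Finset.univ.image fun k : Fin (2 * M i + 1) => Aux11.pt (M i) k) ?_ ?_
  · intro i
    rw [Finset.card_image_of_injective _ (Aux11.pt_inj (M i)), Finset.card_univ, Fintype.card_fin]
    have e1 := Aux11.inBox_iff.1 hb i
    have e2 := Aux11.inBox_iff.1 hG i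
    have e3 := Aux11.inBox_iff.1 (Aux11.inBox_rev N F) i
    have e4 := Aux11.inBox_iff.1 (Aux11.inBox_rev N G) i
    rw [Aux11.dg_apply, hNi] at e1 e2 e3 e4
    have a1 := degreeOf_sub_le i (F * Aux11.rev N G) (Aux11.rev N F * G)
    have a2 := degreeOf_mul_le i F (Aux11.rev N G)
    have a3 := degreeOf_mul_le i (Aux11.rev N F) G
    omega
  · intro x hx
    have hx' : ∀ i, ∃ k : Fin (2 * M i + 1), Aux11.pt (M i) k = x i := by
      intro i
      simpa using hx i
    choose k hk using hx'
    have hz : ∀ i, x i * (starRingEnd ℂ) (x i) = 1 := by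
      intro i
      rw [← hk i]
      exact Aux11.pt_conj _ _
    have hr := hreal k
    have hxe : (fun i : Fin d => Complex.exp (-(((2 * Real.pi : ℝ) : ℂ) * Complex.I) *
              (((k i : ℕ) : ℂ) / (2 * ((M i : ℕ) : ℂ) + 1)))) = x := funext hk
    rw [hxe] at hr
    have hc := Complex.conj_eq_iff_im.2 hr
    rw [map_mul, Complex.conj_conj] at hc
    rw [map_sub, map_mul, map_mul, Aux11.eval_rev hb x hz, Aux11.eval_rev hG x hz, mul_assoc, hc]
    ring
end
end

section
/- Let d ≥ 2, M = {0,…,M_1}×…×{0,…,M_d} ⊂ ℕ^d a finite box, and let x0 : M → ℂ have rank ≥ 2, i.e. the support {n : x0(n) ≠ 0} is not contained in any affine line of ℝ^d. Let φ = (φ(n))_{n∈M} be independent real random variables whose distributions are atomless, and set f(n) := e^{iφ(n)}·x0(n). Then almost surely the polynomial F := Σ_{n∈M} f(n)·X^n ∈ ℂ[X_1,…,X_d] is irreducible up to a monomial factor: there exist n0 ∈ ℕ^d and an irreducible polynomial P ∈ ℂ[X_1,…,X_d] such that F = X^{n0}·P. -/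
open Complex MvPolynomial MeasureTheory

noncomputable section

/-- The z-transform of the masked object `f(m) = e^{iφ(m)} x0(m)`,
`F = Σ_{m ∈ M} f(m) X^m`. -/
noncomputable def ztransform {d : ℕ} (M : Fin d → ℕ)
    (x0 : ((i : Fin d) → Fin (M i + 1)) → ℂ)
    (φ : ((i : Fin d) → Fin (M i + 1)) → ℝ) : MvPolynomial (Fin d) ℂ :=
  ∑ m : (i : Fin d) → Fin (M i + 1),
    MvPolynomial.monomial (Finsupp.equivFunOnFinite.symm fun i => (m i : ℕ))
      (Complex.exp (Complex.I * (φ m : ℂ)) * x0 m)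

namespace Irr

/-- `A` is a (possibly zero) scalar multiple of a monomial. -/
def Mono {σ R : Type*} [CommSemiring R] (A : MvPolynomial σ R) : Prop :=
  ∃ n c, A = monomial n c

theorem mono_of_dvd {σ R : Type*} [CommRing R] [IsDomain R] {A B : MvPolynomial σ R}
    (hB : Mono B) (h0 : B ≠ 0) (h : A ∣ B) : Mono A := by
  obtain ⟨n, c, rfl⟩ := hB
  have hc : c ≠ 0 := by rintro rfl; simp at h0
  obtain ⟨m, b, -, -, rfl⟩ := (dvd_monomial_iff_exists hc).1 h
  exact ⟨m, b, rfl⟩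

theorem exists_of_not_mono {σ R : Type*} [CommSemiring R] {A : MvPolynomial σ R}
    (h : ¬ Mono A) : ∃ m n, m ≠ n ∧ coeff m A ≠ 0 ∧ coeff n A ≠ 0 := by
  classical
  by_contra hcon
  push Not at hcon
  apply h
  by_cases hA : A = 0
  · exact ⟨0, 0, by simp [hA]⟩
  · obtain ⟨m, hm⟩ := MvPolynomial.ne_zero_iff.1 hA
    refine ⟨m, coeff m A, ?_⟩
    ext n
    rw [coeff_monomial]
    split_ifs with h1
    · rw [h1]
    · exact hcon m n h1 hm

theorem not_mono_of {σ R : Type*} [CommSemiring R] {A : MvPolynomial σ R} {m n : σ →₀ ℕ}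
    (hmn : m ≠ n) (hm : coeff m A ≠ 0) (hn : coeff n A ≠ 0) : ¬ Mono A := by
  classical
  rintro ⟨k, c, rfl⟩
  rw [coeff_monomial] at hm hn
  split_ifs at hm hn <;> simp_all

theorem final_assembly {d : ℕ} {F : MvPolynomial (Fin d) ℂ} (hF : ¬ Mono F)
    (h : ∀ A B, F = A * B → Mono A ∨ Mono B) :
    ∃ (n0 : Fin d →₀ ℕ) (P : MvPolynomial (Fin d) ℂ), Irreducible P ∧ F = monomial n0 1 * P := by
  classical
  have hF0 : F ≠ 0 := by rintro rfl; exact hF ⟨0, 0, by simp⟩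
  -- choose P of minimal total degree
  have hex : ∃ k : ℕ, ∃ (n0 : Fin d →₀ ℕ) (P : MvPolynomial (Fin d) ℂ),
      F = monomial n0 1 * P ∧ P.totalDegree = k :=
    ⟨_, 0, F, by simp, rfl⟩
  obtain ⟨n0, P, hFP, hdeg⟩ := Nat.find_spec hex
  have hmin := fun m (hm : m < Nat.find hex) => Nat.find_min hex hm
  have key : ∀ A B, P = A * B → Mono A → IsUnit A := by
    rintro A B hAB ⟨n, c, rfl⟩
    have hP0 : P ≠ 0 := by rintro rfl; simp at hFP; exact hF0 hFP
    have hc : c ≠ 0 := by rintro rfl; simp at hAB; exact hP0 hAB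
    have hB : B ≠ 0 := by rintro rfl; simp at hAB; exact hP0 hAB
    by_cases hn : n = 0
    · subst hn
      exact (IsUnit.mk0 c hc).map (C : ℂ →+* MvPolynomial (Fin d) ℂ)
    · exfalso
      refine hmin (C c * B).totalDegree ?_ ⟨n0 + n, C c * B, ?_, rfl⟩
      · rw [← hdeg, hAB, totalDegree_mul_of_isDomain (by simpa using hc) hB,
          totalDegree_mul_of_isDomain (by simpa using hc) hB, totalDegree_monomial _ hc, totalDegree_C]
        have : n.sum (fun _ e => e) ≠ 0 := by
          intro h0
          apply hn
          ext i
          by_contra hi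
          have := (Finsupp.sum_of_support_subset n (s := n.support) subset_rfl (fun _ e => e) (by simp)).symm.trans h0
          rw [Finset.sum_eq_zero_iff] at this
          exact hi (this i (by simpa using hi))
        omega
      · rw [hFP, hAB, ← mul_assoc, ← mul_assoc, monomial_mul, mul_comm _ (C c), C_mul_monomial]
        simp
  refine ⟨n0, P, ⟨?_, ?_⟩, hFP⟩
  · intro hu
    obtain ⟨c, -, hc⟩ := isUnit_iff_eq_C_of_isReduced.1 hu
    exact hF ⟨n0, c, by rw [hFP, hc, mul_comm, C_mul_monomial]; simp⟩
  · intro A B hAB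
    rcases h (monomial n0 1 * A) B (by rw [hFP, hAB, mul_assoc]) with h1 | h1
    · left
      refine key A B hAB (mono_of_dvd h1 ?_ (dvd_mul_left _ _))
      intro h0
      apply hF0
      rw [hFP, hAB, ← mul_assoc, h0, zero_mul]
    · right
      exact key B A (by rw [hAB, mul_comm]) h1

theorem exists_lift (k Q Ω : Type*) [Field k] [Field Q] [Field Ω] [Algebra k Q] [Algebra k Ω]
    [IsAlgClosed Ω] [Algebra.FiniteType k Q] : Nonempty (Q →ₐ[k] Ω) := by
  have : Module.Finite k Q := finite_of_finite_type_of_isJacobsonRing k Q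
  exact ⟨IsAlgClosed.lift⟩

theorem eval_map_eq {σ R S : Type*} [CommSemiring R] [CommSemiring S] (f : R →+* S) (x : σ → R)
    (P : MvPolynomial σ R) : eval (fun i => f (x i)) (map f P) = f (eval x P) := by
  induction P using MvPolynomial.induction_on <;> simp_all

theorem descent {σ k K Ω : Type*} [Field k] [Field K] [Field Ω] [Algebra k K] [Algebra k Ω]
    [IsAlgClosed Ω] (F : MvPolynomial σ k) (A B : MvPolynomial σ K)
    (h : map (algebraMap k K) F = A * B) (hA : ¬ Mono A) (hB : ¬ Mono B) :
    ∃ A' B' : MvPolynomial σ Ω, map (algebraMap k Ω) F = A' * B' ∧ ¬ Mono A' ∧ ¬ Mono B' := by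
  classical
  let T : Finset K := A.coeffs ∪ B.coeffs ∪ A.coeffs.image (·⁻¹) ∪ B.coeffs.image (·⁻¹)
  let R : Subalgebra k K := Algebra.adjoin k (T : Set K)
  have hTR : ∀ x ∈ T, x ∈ R := fun x hx => Algebra.subset_adjoin hx
  have : Algebra.FiniteType k R := (Subalgebra.fg_iff_finiteType R).1 ⟨T, rfl⟩
  obtain ⟨m, hm⟩ := Ideal.exists_maximal R
  let _ : Field (R ⧸ m) := Ideal.Quotient.field m
  have : Algebra.FiniteType k (R ⧸ m) :=
    Algebra.FiniteType.of_surjective (Ideal.Quotient.mkₐ k m) (Ideal.Quotient.mkₐ_surjective k m)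
  obtain ⟨ψ₀⟩ := exists_lift k (R ⧸ m) Ω
  let ψ : R →ₐ[k] Ω := ψ₀.comp (Ideal.Quotient.mkₐ k m)
  have hA1 : A ∈ Set.range (map (σ := σ) R.val.toRingHom) := by
    rw [← RingHom.coe_range]
    refine mem_range_map_iff_coeffs_subset.2 ?_
    intro x hx
    exact ⟨⟨x, hTR x (by simp [T]; left; exact hx)⟩, rfl⟩
  have hB1 : B ∈ Set.range (map (σ := σ) R.val.toRingHom) := by
    rw [← RingHom.coe_range]
    refine mem_range_map_iff_coeffs_subset.2 ?_
    intro x hx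
    exact ⟨⟨x, hTR x (by simp [T]; right; left; exact hx)⟩, rfl⟩
  obtain ⟨A1, hA1⟩ := hA1
  obtain ⟨B1, hB1⟩ := hB1
  have hinj : Function.Injective (map (σ := σ) R.val.toRingHom) :=
    map_injective _ Subtype.val_injective
  have h1 : map (algebraMap k R) F = A1 * B1 := by
    apply hinj
    rw [map_mul, hA1, hB1, ← h, map_map]
    rfl
  have hnz : ∀ x : R, (x : K) ≠ 0 → (x : K)⁻¹ ∈ T → ψ x ≠ 0 := by
    intro x hx hi h0
    have : ψ (x * ⟨_, hTR _ hi⟩) = 0 := by rw [map_mul, h0, zero_mul]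
    rw [show x * ⟨_, hTR _ hi⟩ = 1 from Subtype.ext (mul_inv_cancel₀ hx), map_one] at this
    exact one_ne_zero this
  have hcA : ∀ n, coeff n A ≠ 0 → coeff n (map ψ.toRingHom A1) ≠ 0 := by
    intro n hn
    have he : coeff n A = (coeff n A1 : R) := by rw [← hA1, coeff_map]; rfl
    rw [coeff_map]
    refine hnz _ (he ▸ hn) ?_
    rw [← he]
    have := coeff_mem_coeffs n hn
    simp only [T, Finset.mem_union, Finset.mem_image]
    left; right; exact ⟨_, this, rfl⟩
  have hcB : ∀ n, coeff n B ≠ 0 → coeff n (map ψ.toRingHom B1) ≠ 0 := by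
    intro n hn
    have he : coeff n B = (coeff n B1 : R) := by rw [← hB1, coeff_map]; rfl
    rw [coeff_map]
    refine hnz _ (he ▸ hn) ?_
    rw [← he]
    have := coeff_mem_coeffs n hn
    simp only [T, Finset.mem_union, Finset.mem_image]
    right; exact ⟨_, this, rfl⟩
  refine ⟨map ψ.toRingHom A1, map ψ.toRingHom B1, ?_, ?_, ?_⟩
  · rw [← map_mul, ← h1, map_map]
    congr 2
    exact (ψ.comp_algebraMap).symm
  · obtain ⟨m, n, hmn, h1, h2⟩ := exists_of_not_mono hA
    exact not_mono_of hmn (hcA m h1) (hcA n h2)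
  · obtain ⟨m, n, hmn, h1, h2⟩ := exists_of_not_mono hB
    exact not_mono_of hmn (hcB m h1) (hcB n h2)

theorem galois_step {σ E Ω : Type*} [Field E] [Field Ω] [Algebra E Ω] [IsGalois E Ω]
    (F : MvPolynomial σ E) (x : σ → E) (hx : ∀ i, x i ≠ 0)
    (hFx : eval x F = 0)
    (hsimple : ∀ A C : MvPolynomial σ Ω, map (algebraMap E Ω) F = A * C →
      eval (fun i => algebraMap E Ω (x i)) A = 0 → eval (fun i => algebraMap E Ω (x i)) C ≠ 0)
    (H : ∀ A R : MvPolynomial σ E, F = A * R → Mono A ∨ Mono R)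
    (A B : MvPolynomial σ Ω) (hAB : map (algebraMap E Ω) F = A * B) : Mono A ∨ Mono B := by
  classical
  set y : σ → Ω := fun i => algebraMap E Ω (x i) with hy
  set G := map (algebraMap E Ω) F with hG
  have hGy : eval y G = 0 := by
    rw [hG, hy, eval_map_eq, hFx, map_zero]
  have hG0 : G ≠ 0 := by
    intro h0
    exact hsimple 0 0 (by rw [h0]; simp) (by simp) (by simp)
  obtain ⟨f, hf, u, hu⟩ := UniqueFactorizationMonoid.exists_prime_factors G hG0
  have hprod : eval y f.prod = 0 := by
    have : eval y (f.prod * u) = 0 := by rw [hu, hGy]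
    rw [map_mul] at this
    exact (mul_eq_zero.1 this).resolve_right ((u.isUnit.map (eval y)).ne_zero)
  have : ∃ A0 ∈ f, eval y A0 = 0 := by
    rw [map_multiset_prod, Multiset.prod_eq_zero_iff, Multiset.mem_map] at hprod
    exact hprod
  obtain ⟨A0, hA0f, hA0y⟩ := this
  have hA0p := hf A0 hA0f
  obtain ⟨n0, hn0⟩ := MvPolynomial.ne_zero_iff.1 hA0p.ne_zero
  set A1 := C (coeff n0 A0)⁻¹ * A0 with hA1
  have hass : Associated A0 A1 := by
    refine associated_of_dvd_dvd (dvd_mul_left _ _) ⟨C (coeff n0 A0), ?_⟩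
    rw [hA1, mul_right_comm, ← C_mul, inv_mul_cancel₀ hn0, C_1, one_mul]
  have hA1p : Prime A1 := hass.prime_iff.1 hA0p
  have hA1c : coeff n0 A1 = 1 := by rw [hA1, coeff_C_mul, inv_mul_cancel₀ hn0]
  have hA1y : eval y A1 = 0 := by rw [hA1, map_mul, hA0y, mul_zero]
  have hdvd : A1 ∣ G := hass.symm.dvd.trans ((Multiset.dvd_prod hA0f).trans (Dvd.intro _ hu))
  obtain ⟨R, hR⟩ := hdvd
  have hGs : ∀ s : Ω ≃ₐ[E] Ω, map (s : Ω →+* Ω) G = G := by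
    intro s
    rw [hG, map_map]
    congr 2
    ext e
    simp
  have hys : ∀ (s : Ω ≃ₐ[E] Ω) (P : MvPolynomial σ Ω), eval y P = 0 → eval y (map (s : Ω →+* Ω) P) = 0 := by
    intro s P hP
    have : y = fun i => (s : Ω →+* Ω) (y i) := by
      ext i; simp [hy]
    rw [this, eval_map_eq, hP, map_zero]
  have hA1s : ∀ s : Ω ≃ₐ[E] Ω, map (s : Ω →+* Ω) A1 = A1 := by
    intro s
    have hp : Prime (map (s : Ω →+* Ω) A1) :=
      (MulEquiv.prime_iff (mapEquiv σ (s : Ω ≃+* Ω))).2 hA1p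
    have hd : map (s : Ω →+* Ω) A1 ∣ A1 * R := by
      rw [← hR, ← hGs s, hR, map_mul (map (s : Ω →+* Ω)) A1 R]
      exact dvd_mul_right _ _
    rcases hp.dvd_or_dvd hd with h1 | ⟨Q, h1⟩
    · obtain ⟨v, hv⟩ := (hp.irreducible.associated_of_dvd hA1p.irreducible h1)
      obtain ⟨c, -, hc⟩ := isUnit_iff_eq_C_of_isReduced.1 v.isUnit
      have := congrArg (coeff n0) hv
      rw [hc, mul_comm, coeff_C_mul, coeff_map, hA1c, map_one, mul_one] at this
      rw [hc, this] at hv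
      simpa using hv
    · exact absurd (by rw [h1, map_mul, hys s A1 hA1y, zero_mul]) (hsimple A1 R hR hA1y)
  have hRs : ∀ s : Ω ≃ₐ[E] Ω, map (s : Ω →+* Ω) R = R := by
    intro s
    have := hGs s
    rw [hR, map_mul, hA1s s] at this
    exact mul_left_cancel₀ hA1p.ne_zero this
  have hdesc : ∀ P : MvPolynomial σ Ω, (∀ s : Ω ≃ₐ[E] Ω, map (s : Ω →+* Ω) P = P) →
      ∃ P', map (algebraMap E Ω) P' = P := by
    intro P hP
    have : P ∈ (map (σ := σ) (algebraMap E Ω)).range := by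
      refine mem_range_map_iff_coeffs_subset.2 ?_
      intro c hc
      obtain ⟨n, -, rfl⟩ := mem_coeffs_iff.1 hc
      rw [InfiniteGalois.mem_range_algebraMap_iff_fixed]
      intro s
      conv_rhs => rw [← hP s]
      rw [coeff_map]; rfl
    exact this
  obtain ⟨AE, hAE⟩ := hdesc A1 hA1s
  obtain ⟨RE, hRE⟩ := hdesc R hRs
  have hF : F = AE * RE := by
    apply map_injective _ (algebraMap E Ω).injective
    rw [map_mul, hAE, hRE, ← hR]
  have hRmono : Mono R := by
    rcases H AE RE hF with ⟨n, c, h1⟩ | ⟨n, c, h1⟩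
    · exfalso
      rw [← hAE, h1, map_monomial, eval_monomial] at hA1y
      rcases mul_eq_zero.1 hA1y with h2 | h2
      · apply hA1p.ne_zero
        rw [← hAE, h1, map_monomial, h2, monomial_zero]
      · rw [Finsupp.prod, Finset.prod_eq_zero_iff] at h2
        obtain ⟨i, -, hi⟩ := h2
        have := eq_zero_of_pow_eq_zero hi
        exact hx i (by simpa [hy] using this)
    · exact ⟨n, _, by rw [← hRE, h1, map_monomial]⟩
  have hR0 : R ≠ 0 := by rintro rfl; apply hG0; rw [hR, mul_zero]
  rcases hA1p.dvd_or_dvd (⟨R, by rw [← hAB, hR]⟩ : A1 ∣ A * B) with ⟨Q, hQ⟩ | ⟨Q, hQ⟩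
  · right
    refine mono_of_dvd hRmono hR0 ⟨Q, ?_⟩
    apply mul_left_cancel₀ hA1p.ne_zero
    rw [← hR, hAB, hQ]; ring
  · left
    refine mono_of_dvd hRmono hR0 ⟨Q, ?_⟩
    apply mul_left_cancel₀ hA1p.ne_zero
    rw [← hR, hAB, hQ]; ring

def PMono {R : Type*} [Semiring R] (A : Polynomial R) : Prop := ∃ n c, A = Polynomial.monomial n c

theorem pmono_of_dvd {R : Type*} [CommRing R] [IsDomain R] {A B : Polynomial R}
    (hB : PMono B) (h0 : B ≠ 0) (h : A ∣ B) : PMono A := by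
  obtain ⟨n, c, rfl⟩ := hB
  obtain ⟨Q, hQ⟩ := h
  have hA0 : A ≠ 0 := by rintro rfl; simp [hQ] at h0
  have hQ0 : Q ≠ 0 := by rintro rfl; simp [hQ] at h0
  have hc : c ≠ 0 := by rintro rfl; simp at h0
  have h1 := congrArg Polynomial.natDegree hQ
  have h2 := congrArg Polynomial.natTrailingDegree hQ
  rw [Polynomial.natDegree_mul hA0 hQ0, Polynomial.natDegree_monomial_eq n hc] at h1
  rw [Polynomial.natTrailingDegree_mul hA0 hQ0, Polynomial.natTrailingDegree_monomial hc] at h2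
  have h3 := Polynomial.natTrailingDegree_le_natDegree A
  have h4 := Polynomial.natTrailingDegree_le_natDegree Q
  refine ⟨A.natDegree, A.coeff A.natDegree, ?_⟩
  ext k
  rw [Polynomial.coeff_monomial]
  split_ifs with hk
  · rw [hk]
  · rcases lt_or_gt_of_ne hk with h5 | h5
    · exact Polynomial.coeff_eq_zero_of_natDegree_lt h5
    · exact Polynomial.coeff_eq_zero_of_lt_natTrailingDegree (by omega)

theorem pmono_of_factors {L : Type*} [Field L] (g : Polynomial L) (hg : g ≠ 0)
    (h : ∀ D, Irreducible D → D ∣ g → Associated D Polynomial.X) : PMono g := by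
  induction g using WfDvdMonoid.induction_on_irreducible with
  | zero => exact absurd rfl hg
  | unit u hu =>
    obtain ⟨c, -, rfl⟩ := Polynomial.isUnit_iff.1 hu
    exact ⟨0, c, rfl⟩
  | mul a i ha hi ih =>
    obtain ⟨n, c, rfl⟩ := ih ha (fun D hD hd => h D hD (hd.mul_left _))
    obtain ⟨v, hv⟩ := (h i hi (dvd_mul_right _ _)).symm
    obtain ⟨e, -, he⟩ := Polynomial.isUnit_iff.1 v.isUnit
    refine ⟨1 + n, e * c, ?_⟩
    rw [← hv, ← he, mul_comm Polynomial.X, Polynomial.C_mul_X_eq_monomial, Polynomial.monomial_mul_monomial]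

theorem linear_pencil {L K : Type*} [Field L] [Field K] [Algebra (Polynomial L) K]
    [IsFractionRing (Polynomial L) K] (W U : Polynomial L) (hU : ¬ PMono U)
    (hcop : ∀ D, Irreducible D → D ∣ W → D ∣ U → Associated D Polynomial.X)
    (A R : Polynomial K)
    (h : W.map ((algebraMap (Polynomial L) K).comp Polynomial.C) +
      Polynomial.C (algebraMap (Polynomial L) K Polynomial.X) *
        U.map ((algebraMap (Polynomial L) K).comp Polynomial.C) = A * R) :
    PMono A ∨ PMono R := by
  classical
  have hU0 : U ≠ 0 := by rintro rfl; exact hU ⟨0, 0, by simp⟩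
  set ι := (algebraMap (Polynomial L) K).comp Polynomial.C with hι
  set g := EuclideanDomain.gcd U W with hgdef
  have hg0 : g ≠ 0 := by
    intro h0
    exact hU0 (EuclideanDomain.gcd_eq_zero_iff.1 h0).1
  have hgm : PMono g := pmono_of_factors g hg0 fun D hD hd =>
    hcop D hD (hd.trans (EuclideanDomain.gcd_dvd_right _ _)) (hd.trans (EuclideanDomain.gcd_dvd_left _ _))
  set U' := U / g with hU'
  set W' := W / g with hW'
  have hUg : U = g * U' := (EuclideanDomain.mul_div_cancel' hg0 (EuclideanDomain.gcd_dvd_left _ _)).symm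
  have hWg : W = g * W' := (EuclideanDomain.mul_div_cancel' hg0 (EuclideanDomain.gcd_dvd_right _ _)).symm
  have hco : IsCoprime U' W' := by
    refine ⟨EuclideanDomain.gcdA U W, EuclideanDomain.gcdB U W, ?_⟩
    apply mul_left_cancel₀ hg0
    have := EuclideanDomain.gcd_eq_gcd_ab U W
    rw [← hgdef] at this
    calc g * (EuclideanDomain.gcdA U W * U' + EuclideanDomain.gcdB U W * W')
        = (g * U') * EuclideanDomain.gcdA U W + (g * W') * EuclideanDomain.gcdB U W := by ring
      _ = g * 1 := by rw [← hUg, ← hWg, ← this, mul_one]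
  have hU'0 : U' ≠ 0 := by intro h0; apply hU0; rw [hUg, h0, mul_zero]
  have hirr : Irreducible (Polynomial.C U' * Polynomial.X + Polynomial.C W') :=
    Polynomial.irreducible_C_mul_X_add_C hU'0 hco.isRelPrime
  have hirr2 := (MulEquiv.irreducible_iff (Polynomial.Bivariate.swap (R := L)).toMulEquiv).2 hirr
  set f : Polynomial (Polynomial L) := U'.map Polynomial.C * Polynomial.C Polynomial.X + W'.map Polynomial.C with hf
  have hfs : Irreducible f := by
    convert hirr2
    simp [hf, Polynomial.Bivariate.swap_C, Polynomial.Bivariate.swap_Y]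
  have hfd : f.natDegree ≠ 0 := by
    intro h0
    apply hU
    have : U'.natDegree = 0 := by
      rw [Polynomial.natDegree_eq_zero_iff_degree_le_zero, Polynomial.degree_le_iff_coeff_zero]
      intro m hm
      have hm' : f.natDegree < m := by rw [h0]; exact_mod_cast hm
      have := Polynomial.coeff_eq_zero_of_natDegree_lt hm'
      rw [hf, Polynomial.coeff_add, Polynomial.coeff_mul_C, Polynomial.coeff_map, Polynomial.coeff_map] at this
      have := congrArg (fun q => Polynomial.coeff q 1) this
      simpa [Polynomial.coeff_C] using this
    rw [Polynomial.eq_C_of_natDegree_eq_zero this] at hUg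
    obtain ⟨n, c, hn⟩ := hgm
    exact ⟨n, c * U'.coeff 0, by rw [hUg, hn, Polynomial.monomial_mul_C]⟩
  have hfK : Irreducible (f.map (algebraMap (Polynomial L) K)) :=
    (Polynomial.IsPrimitive.irreducible_iff_irreducible_map_fraction_map (hfs.isPrimitive hfd)).1 hfs
  have hp := hfK.prime
  have hgm' : PMono (g.map ι) := by
    obtain ⟨n, c, hn⟩ := hgm
    exact ⟨n, ι c, by rw [hn, Polynomial.map_monomial]⟩
  have hg0' : g.map ι ≠ 0 := (Polynomial.map_ne_zero_iff ι.injective).2 hg0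
  have hAR : A * R = f.map (algebraMap (Polynomial L) K) * g.map ι := by
    rw [← h, hf, hUg, hWg]
    simp only [Polynomial.map_mul, Polynomial.map_add, Polynomial.map_map, Polynomial.map_C, ← hι]
    ring
  rcases hp.dvd_or_dvd (Dvd.intro _ hAR.symm : f.map (algebraMap (Polynomial L) K) ∣ A * R) with ⟨Q, hQ⟩ | ⟨Q, hQ⟩
  · right
    refine pmono_of_dvd hgm' hg0' ⟨Q, ?_⟩
    apply mul_left_cancel₀ hp.ne_zero
    rw [← hAR, hQ]; ring
  · left
    refine pmono_of_dvd hgm' hg0' ⟨Q, ?_⟩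
    apply mul_left_cancel₀ hp.ne_zero
    rw [← hAR, hQ]; ring

/-- The field `ℂ(z)`, as the fraction field of the Laurent polynomials. -/
abbrev LL := FractionRing (LaurentPolynomial ℂ)

/-- the powers of `z` -/
def tau (b : ℤ) : LL := algebraMap (LaurentPolynomial ℂ) LL (LaurentPolynomial.T b)

/-- the constants -/
def cc : ℂ →+* LL := (algebraMap (LaurentPolynomial ℂ) LL).comp LaurentPolynomial.C

theorem tau_ne_zero (b : ℤ) : tau b ≠ 0 := by
  intro h
  have h1 : tau (b + -b) = 0 := by
    rw [tau, LaurentPolynomial.T_add, map_mul]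
    rw [tau] at h
    rw [h, zero_mul]
  simp [tau] at h1

theorem tau_zero : tau 0 = 1 := by simp [tau]

theorem tau_add (a b : ℤ) : tau (a + b) = tau a * tau b := by
  rw [tau, tau, tau, LaurentPolynomial.T_add, map_mul]

/-- the polynomial `U` of the pencil `W + s U` -/
def polU (η : ℂ) (αp αq : ℕ) (m : ℤ) : Polynomial LL :=
  Polynomial.C (tau m) *
    (Polynomial.C (η ^ αp) * Polynomial.X ^ αq - Polynomial.C (η ^ αq) * Polynomial.X ^ αp :
      Polynomial ℂ).map cc

/-- the polynomial `W` of the pencil `W + s U` -/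
def polW {ι : Type*} (S : Finset ι) (c : ι → ℂ) (α : ι → ℕ) (β : ι → ℤ) (η : ℂ) (αp : ℕ) (m : ℤ) :
    Polynomial LL :=
  ∑ n ∈ S, (Polynomial.C (cc (c n * η ^ αp) * tau (β n)) * Polynomial.X ^ (α n)
    - Polynomial.C (cc (c n * η ^ α n) * tau m) * Polynomial.X ^ αp)

theorem polU_not_pmono (η : ℂ) (hη : η ≠ 0) (αp αq : ℕ) (hpq : αp < αq) (m : ℤ) :
    ¬ PMono (polU η αp αq m) := by
  rintro ⟨n, e, h⟩
  have h1 := congrArg (fun P => Polynomial.coeff P αp) h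
  have h2 := congrArg (fun P => Polynomial.coeff P αq) h
  simp only [polU, Polynomial.coeff_C_mul, Polynomial.coeff_map, Polynomial.coeff_sub,
    Polynomial.coeff_X_pow, Polynomial.coeff_monomial, hpq.ne, hpq.ne', if_false, if_true] at h1 h2
  have e1 : tau m * cc (η ^ αp * 0 - η ^ αq * 1) ≠ 0 := by
    apply mul_ne_zero (tau_ne_zero m)
    simp [hη]
  have e2 : tau m * cc (η ^ αp * 1 - η ^ αq * 0) ≠ 0 := by
    apply mul_ne_zero (tau_ne_zero m)
    simp [hη]
  rw [h1] at e1
  rw [h2] at e2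
  split_ifs at e1 e2 <;> first | omega | simp at e1 e2

theorem polUW_coprime {ι : Type*} (S : Finset ι) (c : ι → ℂ) (α : ι → ℕ) (hα : Function.Injective α)
    (β : ι → ℤ) (η : ℂ)
    (αp αq : ℕ) (hpq : αp < αq) (m : ℤ) (k₀ : IntermediateField ℚ ℂ) (hc : ∀ n ∈ S, c n ∈ k₀)
    (hη : Transcendental k₀ η) (r : ι) (hr : r ∈ S) (hcr : c r ≠ 0) (hrm : β r ≠ m)
    (D : Polynomial LL) (hD : Irreducible D) (hDW : D ∣ polW S c α β η αp m)
    (hDU : D ∣ polU η αp αq m) : Associated D Polynomial.X := by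
  classical
  have hη0 : η ≠ 0 := by
    rintro rfl
    exact hη isAlgebraic_zero
  set U1 : Polynomial ℂ :=
    Polynomial.C (η ^ αp) * Polynomial.X ^ αq - Polynomial.C (η ^ αq) * Polynomial.X ^ αp with hU1
  have hU10 : U1 ≠ 0 := by
    intro h0
    have := congrArg (fun P => Polynomial.coeff P αq) h0
    simp only [hU1, Polynomial.coeff_C_mul, Polynomial.coeff_sub, Polynomial.coeff_X_pow,
      hpq.ne', if_false, if_true, Polynomial.coeff_zero] at this
    simp [hη0] at this
  have hp := hD.prime
  have hD1 : D ∣ U1.map cc := by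
    rw [polU] at hDU
    rcases hp.dvd_or_dvd hDU with h | h
    · exact absurd (isUnit_of_dvd_unit h ((IsUnit.mk0 _ (tau_ne_zero m)).map Polynomial.C)) hD.not_isUnit
    · exact h
  have hroot : ∃ a ∈ U1.roots, D ∣ Polynomial.X - Polynomial.C (cc a) := by
    rw [(IsAlgClosed.splits U1).eq_prod_roots, Polynomial.map_mul, Polynomial.map_C,
      Polynomial.map_multiset_prod, Multiset.map_map] at hD1
    rcases hp.dvd_or_dvd hD1 with h | h
    · refine absurd (isUnit_of_dvd_unit h ((IsUnit.mk0 _ ?_).map Polynomial.C)) hD.not_isUnit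
      simpa using hU10
    · obtain ⟨P, hP, hd⟩ := hp.exists_mem_multiset_dvd h
      obtain ⟨a, ha, rfl⟩ := Multiset.mem_map.1 hP
      exact ⟨a, ha, by simpa using hd⟩
  obtain ⟨a, ha, hDa⟩ := hroot
  have hass : Associated D (Polynomial.X - Polynomial.C (cc a)) :=
    hD.associated_of_dvd (Polynomial.irreducible_X_sub_C _) hDa
  by_cases ha0 : a = 0
  · simpa [ha0] using hass
  exfalso
  have haU : η ^ αp * a ^ αq = η ^ αq * a ^ αp := by
    have := (Polynomial.mem_roots'.1 ha).2
    rw [Polynomial.IsRoot.def] at this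
    simpa [hU1, sub_eq_zero] using this
  have hWa : Polynomial.eval (cc a) (polW S c α β η αp m) = 0 :=
    Polynomial.dvd_iff_isRoot.1 (hass.symm.dvd.trans hDW)
  have hL : (∑ n ∈ S, (LaurentPolynomial.C (c n * η ^ αp * a ^ α n) * LaurentPolynomial.T (β n)
      - LaurentPolynomial.C (c n * η ^ α n * a ^ αp) * LaurentPolynomial.T m) : LaurentPolynomial ℂ) = 0 := by
    apply IsFractionRing.injective (LaurentPolynomial ℂ) LL
    rw [map_zero, ← hWa, polW, Polynomial.eval_finsetSum, map_sum]
    refine Finset.sum_congr rfl fun n _ => ?_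
    simp only [map_sub, map_mul, Polynomial.eval_sub, Polynomial.eval_mul, Polynomial.eval_C,
      Polynomial.eval_pow, Polynomial.eval_X, tau, cc, RingHom.comp_apply, map_pow]
    ring
  have hsum : ∑ n ∈ S with β n = β r, c n * η ^ αp * a ^ α n = 0 := by
    have := congrArg (fun P : LaurentPolynomial ℂ => P.coeff (β r)) hL
    simp only [← LaurentPolynomial.single_eq_C_mul_T] at this
    rw [Finset.sum_filter]
    refine Eq.trans ?_ (this.trans (by simp))
    simp only [AddMonoidAlgebra.coeff_sum, AddMonoidAlgebra.coeff_sub, AddMonoidAlgebra.coeff_single]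
    rw [Finsupp.finsetSum_apply]
    refine Finset.sum_congr rfl fun n _ => ?_
    simp [Finsupp.single_apply, Ne.symm hrm]
    split_ifs <;> rfl
  have hsum2 : ∑ n ∈ S with β n = β r, c n * a ^ α n = 0 := by
    have h2 : η ^ αp * ∑ n ∈ S with β n = β r, c n * a ^ α n = 0 := by
      rw [← hsum, Finset.mul_sum]
      exact Finset.sum_congr rfl fun n _ => by ring
    exact (mul_eq_zero.1 h2).resolve_left (pow_ne_zero _ hη0)
  have halg : IsAlgebraic k₀ a := by
    refine ⟨∑ n ∈ (S.filter (fun n => β n = β r)).attach,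
      Polynomial.monomial (α n) ⟨c n, hc n (Finset.mem_filter.1 n.2).1⟩, ?_, ?_⟩
    · intro h0
      have := congrArg (fun P => Polynomial.coeff P (α r)) h0
      simp only [Polynomial.finsetSum_coeff, Polynomial.coeff_monomial, Polynomial.coeff_zero] at this
      rw [Finset.sum_eq_single ⟨r, by simp [hr]⟩] at this
      · simp at this
        exact hcr (congrArg Subtype.val this)
      · rintro ⟨b, hb⟩ _ hne
        rw [if_neg]
        intro h
        exact hne (Subtype.ext (hα h))
      · simp
    · rw [map_sum]
      simp only [Polynomial.aeval_monomial]
      rw [← hsum2, ← Finset.sum_attach (S.filter (fun n => β n = β r))]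
      rfl
  apply hη
  have hd : αq - αp ≠ 0 := by omega
  have hpow : η ^ (αq - αp) = a ^ (αq - αp) := by
    have h1 : η ^ αq = η ^ αp * η ^ (αq - αp) := by rw [← pow_add]; congr 1; omega
    have h2 : a ^ αq = a ^ αp * a ^ (αq - αp) := by rw [← pow_add]; congr 1; omega
    rw [h1, h2] at haU
    have h3 : (η ^ αp * a ^ αp) ≠ 0 := mul_ne_zero (pow_ne_zero _ hη0) (pow_ne_zero _ ha0)
    apply mul_left_cancel₀ h3
    linear_combination -haU
  have : IsAlgebraic k₀ (η ^ (αq - αp)) := by rw [hpow]; exact halg.pow _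
  exact this.of_pow (Nat.pos_of_ne_zero hd)

/-- weight of an exponent vector -/
def wt {σ : Type*} [Fintype σ] {Z : Type*} [CommSemiring Z] (a : σ → Z) (n : σ →₀ ℕ) : Z :=
  ∑ l, (n l : Z) * a l

theorem tau_nsmul (k : ℕ) (b : ℤ) : tau ((k : ℤ) * b) = tau b ^ k := by
  induction k with
  | zero => simp [tau_zero]
  | succ k ih =>
    rw [pow_succ, ← ih, ← tau_add]
    congr 1
    push_cast
    ring

theorem tau_sum {σ : Type*} (s : Finset σ) (f : σ → ℤ) :
    tau (∑ l ∈ s, f l) = ∏ l ∈ s, tau (f l) := by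
  classical
  induction s using Finset.induction_on with
  | empty => simp [tau_zero]
  | insert x s hx ih => rw [Finset.sum_insert hx, Finset.prod_insert hx, tau_add, ih]

/-- fraction field of `LL[s]` -/
abbrev KK := FractionRing (Polynomial LL)

/-- the field `ℂ(s)` -/
abbrev EE := FractionRing (Polynomial ℂ)

theorem inj_psi : Function.Injective
    ((algebraMap (Polynomial LL) KK).comp (Polynomial.mapRingHom cc)) := by
  rw [RingHom.coe_comp]
  refine (IsFractionRing.injective (Polynomial LL) KK).comp ?_
  exact Polynomial.map_injective _ cc.injective

/-- `ℂ(s) → LL(s)` -/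
def psi : EE →+* KK := IsFractionRing.lift inj_psi

/-- constants of `LL(s)` -/
def kap : LL →+* KK := (algebraMap (Polynomial LL) KK).comp Polynomial.C

/-- constants of `ℂ(s)` -/
def kE : ℂ →+* EE := (algebraMap (Polynomial ℂ) EE).comp Polynomial.C

/-- the variable of `ℂ(s)` -/
def sE : EE := algebraMap (Polynomial ℂ) EE Polynomial.X

theorem psi_kE (z : ℂ) : psi (kE z) = kap (cc z) := by
  simp [psi, kE, kap]

theorem psi_sE : psi sE = algebraMap (Polynomial LL) KK Polynomial.X := by
  simp [psi, sE]

/-- the substitution `X_l ↦ z^{b_l} y^{a_l}` -/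
def Phi {σ : Type*} (a : σ → ℕ) (b : σ → ℤ) : MvPolynomial σ EE →+* Polynomial KK :=
  eval₂Hom (Polynomial.C.comp psi) (fun l => Polynomial.monomial (a l) (kap (tau (b l))))

theorem Phi_monomial {σ : Type*} [Fintype σ] (a : σ → ℕ) (b : σ → ℤ) (n : σ →₀ ℕ) (x : EE) :
    Phi a b (monomial n x) =
      Polynomial.monomial (wt a n) (psi x * kap (tau (wt b n))) := by
  rw [Phi, coe_eval₂Hom, eval₂_monomial, Finsupp.prod_fintype _ _ (by simp)]
  rw [wt, wt, tau_sum, map_prod]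
  simp only [tau_nsmul, map_pow, Polynomial.monomial_pow, RingHom.comp_apply]
  rw [← Polynomial.C_mul_monomial]
  congr 1
  rw [← Polynomial.C_mul_X_pow_eq_monomial, map_prod, ← Finset.prod_pow_eq_pow_sum,
    ← Finset.prod_mul_distrib]
  refine Finset.prod_congr rfl fun l _ => ?_
  rw [Polynomial.C_mul_X_pow_eq_monomial, mul_comm]
  simp

theorem mono_of_pmono {σ : Type*} [Fintype σ] (a : σ → ℕ) (b : σ → ℤ) (A : MvPolynomial σ EE)
    (hinj : ∀ m ∈ A.support, ∀ n ∈ A.support, wt a m = wt a n → m = n)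
    (h : PMono (Phi a b A)) : Mono A := by
  classical
  by_contra hA
  obtain ⟨m, n, hmn, hm, hn⟩ := exists_of_not_mono hA
  have key : ∀ m, coeff m A ≠ 0 → (Phi a b A).coeff (wt a m) ≠ 0 := by
    intro m hm
    have : Phi a b A = ∑ n ∈ A.support,
        Polynomial.monomial (wt a n) (psi (coeff n A) * kap (tau (wt b n))) := by
      conv_lhs => rw [A.as_sum, map_sum]
      exact Finset.sum_congr rfl fun n _ => Phi_monomial a b n _
    rw [this, Polynomial.finsetSum_coeff, Finset.sum_eq_single m]
    · rw [Polynomial.coeff_monomial, if_pos rfl]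
      refine mul_ne_zero ?_ ?_
      · exact (map_ne_zero psi).2 hm
      · exact (map_ne_zero kap).2 (tau_ne_zero _)
    · intro n hn hne
      rw [Polynomial.coeff_monomial, if_neg]
      intro h
      exact hne (hinj n hn m (mem_support_iff.2 hm) h)
    · intro h
      exact absurd (mem_support_iff.2 hm) h
  obtain ⟨k, c, hk⟩ := h
  have h1 := key m hm
  have h2 := key n hn
  rw [hk, Polynomial.coeff_monomial] at h1 h2
  have e1 : k = wt a m := by by_contra h; simp [h] at h1
  have e2 : k = wt a n := by by_contra h; simp [h] at h2
  exact hmn (hinj m (mem_support_iff.2 hm) n (mem_support_iff.2 hn) (e1.symm.trans e2))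

theorem support_le_of_mul {σ R : Type*} [CommRing R] [IsDomain R] {F A B : MvPolynomial σ R}
    (hF : F ≠ 0) (h : F = A * B) (M : σ → ℕ) (hM : ∀ n ∈ F.support, ∀ l, n l ≤ M l) :
    ∀ n ∈ A.support, ∀ l, n l ≤ M l := by
  intro n hn l
  have hA : A ≠ 0 := by rintro rfl; simp at hn
  have hB : B ≠ 0 := by rintro rfl; simp [h] at hF
  have h1 : n l ≤ degreeOf l A := monomial_le_degreeOf l hn
  have h2 : degreeOf l F = degreeOf l A + degreeOf l B := by
    rw [h, degreeOf_mul_eq hA hB]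
  have h3 : degreeOf l F ≤ M l := by
    rw [degreeOf_eq_sup]
    exact Finset.sup_le fun n hn => hM n hn l
  omega

/-- the specialised coefficients -/
def cE {ι : Type*} [Fintype ι] [DecidableEq ι] (c : ι → ℂ) (α : ι → ℕ) (η : ℂ) (p q : ι) : ι → EE :=
  fun n => if n = p then
      - ((∑ n ∈ (Finset.univ.erase p).erase q, kE (c n * η ^ α n)) + sE * kE (η ^ α q)) / kE (η ^ α p)
    else if n = q then sE else kE (c n)

theorem sum_split {ι R : Type*} [Fintype ι] [DecidableEq ι] [AddCommMonoid R] {p q : ι} (hpq : p ≠ q)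
    (f : ι → R) : ∑ n, f n = f p + (f q + ∑ n ∈ (Finset.univ.erase p).erase q, f n) := by
  rw [Finset.add_sum_erase _ _ (by simp [hpq.symm]), Finset.add_sum_erase _ _ (by simp)]

theorem cE_of_mem {ι : Type*} [Fintype ι] [DecidableEq ι] (c : ι → ℂ) (α : ι → ℕ) (η : ℂ) (p q n : ι)
    (hn : n ∈ (Finset.univ.erase p).erase q) : cE c α η p q n = kE (c n) := by
  have h1 : n ≠ q := (Finset.mem_erase.1 hn).1
  have h2 : n ≠ p := (Finset.mem_erase.1 (Finset.mem_erase.1 hn).2).1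
  simp [cE, h1, h2]

theorem cE_q {ι : Type*} [Fintype ι] [DecidableEq ι] (c : ι → ℂ) (α : ι → ℕ) (η : ℂ) (p q : ι)
    (hpq : p ≠ q) : cE c α η p q q = sE := by
  simp [cE, hpq.symm]

theorem cE_p {ι : Type*} [Fintype ι] [DecidableEq ι] (c : ι → ℂ) (α : ι → ℕ) (η : ℂ) (hη : η ≠ 0)
    (p q : ι) : cE c α η p q p * kE (η ^ α p) =
      - ((∑ n ∈ (Finset.univ.erase p).erase q, kE (c n * η ^ α n)) + sE * kE (η ^ α q)) := by
  have : kE (η ^ α p) ≠ 0 := (map_ne_zero kE).2 (pow_ne_zero _ hη)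
  rw [cE, if_pos rfl, div_mul_cancel₀ _ this]

theorem PMono_C_mul {K : Type*} [Field K] (x : K) (hx : x ≠ 0) (A : Polynomial K)
    (h : PMono (Polynomial.C x * A)) : PMono A := by
  obtain ⟨n, c, h⟩ := h
  refine ⟨n, x⁻¹ * c, ?_⟩
  rw [← Polynomial.C_mul_monomial, ← h, ← mul_assoc, ← Polynomial.C_mul, inv_mul_cancel₀ hx]
  simp

theorem key_ident {ι K : Type*} [Field K] (S : Finset ι) (κ : LL →+* K) (c : ι → ℂ) (α : ι → ℕ)
    (β : ι → ℤ) (η : ℂ) (αp αq : ℕ) (m : ℤ) (s cp : K)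
    (hp1 : cp * κ (cc (η ^ αp)) =
      - ((∑ n ∈ S, κ (cc (c n * η ^ α n))) + s * κ (cc (η ^ αq)))) :
    Polynomial.C (κ (cc (η ^ αp))) * (Polynomial.monomial αp (cp * κ (tau m)) +
      (Polynomial.monomial αq (s * κ (tau m)) +
        ∑ n ∈ S, Polynomial.monomial (α n) (κ (cc (c n)) * κ (tau (β n))))) =
    (polW S c α β η αp m).map κ + Polynomial.C s * (polU η αp αq m).map κ := by
  have hT : Polynomial.C (κ (cc (η ^ αp))) * Polynomial.monomial αp (cp * κ (tau m)) =
      - ((∑ n ∈ S, Polynomial.C (κ (cc (c n * η ^ α n)))) + Polynomial.C s *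
        Polynomial.C (κ (cc (η ^ αq)))) * Polynomial.C (κ (tau m)) * Polynomial.X ^ αp := by
    have h2 := congrArg (fun x : K => Polynomial.C x) hp1
    simp only [Polynomial.C_mul, Polynomial.C_neg, Polynomial.C_add, map_sum] at h2
    rw [← h2, ← Polynomial.C_mul_X_pow_eq_monomial, Polynomial.C_mul]
    ring
  have hS : (polW S c α β η αp m).map κ =
      Polynomial.C (κ (cc (η ^ αp))) *
        ∑ n ∈ S, Polynomial.monomial (α n) (κ (cc (c n)) * κ (tau (β n))) -
      (∑ n ∈ S, Polynomial.C (κ (cc (c n * η ^ α n)))) * Polynomial.C (κ (tau m)) *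
        Polynomial.X ^ αp := by
    rw [polW, Polynomial.map_sum, Finset.mul_sum, Finset.sum_mul, Finset.sum_mul,
      ← Finset.sum_sub_distrib]
    refine Finset.sum_congr rfl fun n _ => ?_
    simp only [Polynomial.map_sub, Polynomial.map_mul, Polynomial.map_pow, Polynomial.map_X,
      Polynomial.map_C, ← Polynomial.C_mul_X_pow_eq_monomial, RingHom.map_mul]
    ring
  have hU : (polU η αp αq m).map κ = Polynomial.C (κ (tau m)) *
      (Polynomial.C (κ (cc (η ^ αp))) * Polynomial.X ^ αq -
        Polynomial.C (κ (cc (η ^ αq))) * Polynomial.X ^ αp) := by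
    simp only [polU, Polynomial.map_sub, Polynomial.map_mul, Polynomial.map_pow, Polynomial.map_X,
      Polynomial.map_C]
  rw [mul_add, hT, hS, hU, ← Polynomial.C_mul_X_pow_eq_monomial, Polynomial.C_mul]
  ring

theorem hp1_map {ι E K : Type*} [Field E] [Field K] (f : E →+* K) (S : Finset ι) (x y s z : E)
    (g : ι → E) (h : x * y = - ((∑ n ∈ S, g n) + s * z)) :
    f x * f y = - ((∑ n ∈ S, f (g n)) + f s * f z) := by
  rw [← map_mul, h, map_neg, map_add, map_mul, map_sum]

theorem H_step {σ ι : Type*} [Fintype σ] [Fintype ι] [DecidableEq ι] (e : ι → σ →₀ ℕ)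
    (M : σ → ℕ) (hM : ∀ n l, e n l ≤ M l)
    (a : σ → ℕ) (b : σ → ℤ)
    (hinj : ∀ m n : σ →₀ ℕ, (∀ l, m l ≤ M l) → (∀ l, n l ≤ M l) → wt a m = wt a n → m = n)
    (he : Function.Injective e)
    (c : ι → ℂ) (η : ℂ) (p q r : ι) (hpq : wt a (e p) < wt a (e q))
    (hb : wt b (e p) = wt b (e q)) (hbr : wt b (e r) ≠ wt b (e p)) (hcr : c r ≠ 0)
    (k₀ : IntermediateField ℚ ℂ) (hc : ∀ n, n ≠ p → n ≠ q → c n ∈ k₀)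
    (hη : Transcendental k₀ η)
    (A R : MvPolynomial σ EE)
    (h : ∑ n, monomial (e n) (cE c (fun n => wt a (e n)) η p q n) = A * R) : Mono A ∨ Mono R := by
  classical
  set α : ι → ℕ := fun n => wt a (e n) with hα
  set β : ι → ℤ := fun n => wt b (e n) with hβ
  have hαinj : Function.Injective α := fun m n hmn => he (hinj _ _ (hM m) (hM n) hmn)
  have hne : p ≠ q := by rintro rfl; exact lt_irrefl _ hpq
  have hη0 : η ≠ 0 := by
    rintro rfl
    exact hη isAlgebraic_zero
  set S := (Finset.univ.erase p).erase q with hS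
  have hrS : r ∈ S := by
    simp only [hS, Finset.mem_erase, Finset.mem_univ, and_true]
    refine ⟨?_, ?_⟩
    · rintro rfl; exact hbr hb.symm
    · rintro rfl; exact hbr rfl
  set F : MvPolynomial σ EE := ∑ n, monomial (e n) (cE c α η p q n) with hF
  have hF0 : F ≠ 0 := by
    intro h0
    have := congrArg (coeff (e q)) h0
    rw [hF, coeff_sum, Finset.sum_eq_single q] at this
    · rw [coeff_monomial, if_pos rfl, cE_q _ _ _ _ _ hne, coeff_zero] at this
      have hs : (sE : EE) ≠ 0 := by
        rw [sE, Ne, IsFractionRing.to_map_eq_zero_iff]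
        exact Polynomial.X_ne_zero
      exact hs this
    · intro n _ hn
      rw [coeff_monomial, if_neg]
      exact fun h => hn (he h)
    · simp
  have hsup : ∀ n ∈ F.support, ∀ l, n l ≤ M l := by
    intro n hn l
    have h1 := MvPolynomial.support_sum hn
    simp only [Finset.mem_biUnion] at h1
    obtain ⟨i, _, hi⟩ := h1
    have := support_monomial_subset hi
    rw [Finset.mem_singleton] at this
    rw [this]
    exact hM i l
  have key : Polynomial.C (kap (cc (η ^ α p))) * Phi a b F =
      (polW S c α β η (α p) (β p)).map ((algebraMap (Polynomial LL) KK).comp Polynomial.C) +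
      Polynomial.C (algebraMap (Polynomial LL) KK Polynomial.X) *
        (polU η (α p) (α q) (β p)).map ((algebraMap (Polynomial LL) KK).comp Polynomial.C) := by
    have hk : ((algebraMap (Polynomial LL) KK).comp Polynomial.C) = kap := rfl
    have hp1 := hp1_map psi S _ _ _ _ _ (cE_p c α η hη0 p q)
    rw [psi_kE, psi_sE, psi_kE] at hp1
    have hS1 : ∑ n ∈ S, Phi a b (monomial (e n) (cE c α η p q n)) =
        ∑ n ∈ S, Polynomial.monomial (α n) (kap (cc (c n)) * kap (tau (β n))) := by
      refine Finset.sum_congr rfl fun n hn => ?_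
      rw [Phi_monomial, cE_of_mem _ _ _ _ _ _ hn, psi_kE]
    have hS2 : ∑ n ∈ S, psi (kE (c n * η ^ α n)) = ∑ n ∈ S, kap (cc (c n * η ^ α n)) :=
      Finset.sum_congr rfl fun n _ => psi_kE _
    rw [hS2] at hp1
    have hPF : Phi a b F = ∑ n, Phi a b (monomial (e n) (cE c α η p q n)) := map_sum (Phi a b) _ _
    rw [hk, hPF, sum_split hne, hS1, Phi_monomial, Phi_monomial, cE_q _ _ _ _ _ hne, psi_sE, ← hb]
    exact key_ident S kap c α β η (α p) (α q) (β p) _ _ hp1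
  have h3 := linear_pencil (L := LL) (K := KK) (polW S c α β η (α p) (β p)) (polU η (α p) (α q) (β p))
    (polU_not_pmono η hη0 _ _ hpq _)
    (fun D hD h1 h2 => polUW_coprime S c α hαinj β η (α p) (α q) hpq (β p) k₀
      (fun n hn => hc n (Finset.mem_erase.1 (Finset.mem_erase.1 hn).2).1 (Finset.mem_erase.1 hn).1)
      hη r hrS hcr hbr D hD h1 h2)
    (Polynomial.C (kap (cc (η ^ α p))) * Phi a b A) (Phi a b R)
    (by rw [← key, h, map_mul, mul_assoc])
  have hx : kap (cc (η ^ α p)) ≠ 0 :=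
    (map_ne_zero kap).2 ((map_ne_zero cc).2 (pow_ne_zero _ hη0))
  have hA := support_le_of_mul hF0 h M hsup
  have hR := support_le_of_mul hF0 (h.trans (mul_comm _ _)) M hsup
  rcases h3 with h3 | h3
  · left
    exact mono_of_pmono a b A (fun m hm n hn => hinj m n (hA m hm) (hA n hn)) (PMono_C_mul _ hx _ h3)
  · right
    exact mono_of_pmono a b R (fun m hm n hn => hinj m n (hR m hm) (hR n hn)) h3

theorem algind_swap {ι E : Type*} [Field E] [Algebra ℚ E] [DecidableEq ι]
    (g : ι → E) (hg : AlgebraicIndependent ℚ g) (p q : ι) (hne : p ≠ q) (S : Finset ι) (hp : p ∉ S)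
    (hq : q ∉ S) (α : ι → ℕ) (hα : Function.Injective α) (t : E)
    (ht : t * g p ^ α p = - ((∑ n ∈ S, g n * g p ^ α n) + g q * g p ^ α q)) :
    AlgebraicIndependent ℚ (Function.update g p t) := by
  classical
  obtain ⟨h1, h2⟩ := (AlgebraicIndependent.iff_transcendental_adjoin_image p).1 hg
  have him : Function.update g p t '' {p}ᶜ = g '' {p}ᶜ := by
    apply Set.image_congr
    intro a ha
    exact Function.update_of_ne ha _ _
  refine (AlgebraicIndependent.iff_transcendental_adjoin_image p).2 ⟨?_, ?_⟩
  · convert h1 using 2 with j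
    exact Function.update_of_ne j.2 _ _
  · rw [him, Function.update_self]
    intro halg
    apply h2
    set B := Algebra.adjoin ℚ (g '' {p}ᶜ) with hB
    have hmem : ∀ n, n ≠ p → g n ∈ Subalgebra.algebraicClosure B E := fun n hn =>
      (Subalgebra.mem_algebraicClosure _ _).2
        (isAlgebraic_algebraMap (⟨g n, Algebra.subset_adjoin ⟨n, hn, rfl⟩⟩ : B))
    have ht' : t ∈ Subalgebra.algebraicClosure B E := (Subalgebra.mem_algebraicClosure _ _).2 halg
    have hSp : ∀ n ∈ S, n ≠ p := fun n hn h => hp (h ▸ hn)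
    have hr : IsAlgebraic (Subalgebra.algebraicClosure B E) (g p) := by
      refine ⟨Polynomial.monomial (α p) ⟨t, ht'⟩ + (Polynomial.monomial (α q) ⟨g q, hmem q hne.symm⟩ +
        ∑ n ∈ S.attach, Polynomial.monomial (α n) ⟨g n, hmem n (hSp n n.2)⟩), ?_, ?_⟩
      · intro h0
        have := congrArg (fun P => Polynomial.coeff P (α q)) h0
        simp only [Polynomial.coeff_add, Polynomial.finsetSum_coeff, Polynomial.coeff_monomial,
          Polynomial.coeff_zero] at this
        rw [if_neg (fun h => hne (hα h)), if_pos trivial, Finset.sum_eq_zero, zero_add, add_zero] at this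
        · have h3 : g q = 0 := congrArg Subtype.val this
          exact hg.ne_zero q h3
        · intro x _
          rw [if_neg]
          intro h
          exact hq (hα h ▸ x.2)
      · rw [map_add, map_add, map_sum]
        simp only [Polynomial.aeval_monomial]
        have e3 := Finset.sum_attach S (fun n => g n * g p ^ α n)
        change t * g p ^ α p + (g q * g p ^ α q + ∑ n ∈ S.attach, g n * g p ^ α n) = 0
        rw [e3, ht]
        ring
    exact hr.restrictScalars B

theorem algind_g {ι E : Type*} [Field E] [Algebra ℚ E] [Algebra ℂ E] [IsScalarTower ℚ ℂ E]
    [DecidableEq ι] (c : ι → ℂ) (hc : AlgebraicIndependent ℚ c) (p q : ι) (s : E)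
    (hs : Transcendental ℂ s) :
    AlgebraicIndependent ℚ
      (fun n => if n = q then s else if n = p then algebraMap ℂ E (c q) else algebraMap ℂ E (c n)) := by
  let f : {n // n ≠ q} → ι := fun n => if n.1 = p then q else n
  have hf : Function.Injective f := by
    rintro ⟨m, hm⟩ ⟨n, hn⟩ h
    simp only [f] at h
    apply Subtype.ext
    split_ifs at h with h1 h2 h2
    · simp [h1, h2]
    · exact absurd h.symm hn
    · exact absurd h hm
    · exact h
  have h1 := hc.comp f hf
  have h2 : AlgebraicIndependent ℚ (algebraMap ℂ E ∘ (c ∘ f)) :=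
    h1.map' (f := IsScalarTower.toAlgHom ℚ ℂ E) (algebraMap ℂ E).injective
  refine (AlgebraicIndependent.iff_transcendental_adjoin_image q).2 ⟨?_, ?_⟩
  · convert h2 using 2 with j
    simp only [Function.comp, f, if_neg j.2]
    split_ifs <;> rfl
  · rw [if_pos rfl]
    set B := Algebra.adjoin ℚ ((fun n => if n = q then s else if n = p then algebraMap ℂ E (c q)
      else algebraMap ℂ E (c n)) '' {q}ᶜ) with hB
    have hle : B ≤ (IsScalarTower.toAlgHom ℚ ℂ E).range := by
      rw [hB, Algebra.adjoin_le_iff]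
      rintro _ ⟨n, hn, rfl⟩
      have hn' : n ≠ q := hn
      simp only [if_neg hn']
      split_ifs
      · exact ⟨c q, rfl⟩
      · exact ⟨c n, rfl⟩
    intro halg
    apply hs
    obtain ⟨P, hP0, hP⟩ := halg
    have hlift : ∀ b : B, ∃ z : ℂ, algebraMap ℂ E z = b := fun b => by
      obtain ⟨z, hz⟩ := hle b.2
      exact ⟨z, hz⟩
    have hPl : ∃ Q : Polynomial ℂ, Q.map (algebraMap ℂ E) = P.map (algebraMap B E) := by
      change P.map (algebraMap B E) ∈ (Polynomial.mapRingHom (algebraMap ℂ E)).range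
      rw [Polynomial.mem_map_range]
      intro n
      rw [Polynomial.coeff_map]
      exact hlift _
    obtain ⟨Q, hQ⟩ := hPl
    refine ⟨Q, ?_, ?_⟩
    · rintro rfl
      rw [Polynomial.map_zero] at hQ
      have : Function.Injective (algebraMap B E) := Subtype.val_injective
      exact hP0 ((Polynomial.map_eq_zero_iff this).1 hQ.symm)
    · rw [← Polynomial.eval_map_algebraMap, hQ, Polynomial.eval_map_algebraMap, hP]

theorem kE_eq : kE = algebraMap ℂ EE := rfl

theorem transc_sE : Transcendental ℂ (sE : EE) := by
  have h : Transcendental ℂ (Polynomial.X : Polynomial ℂ) := Polynomial.transcendental_X ℂ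
  rw [sE]
  exact (transcendental_algebraMap_iff (IsFractionRing.injective (Polynomial ℂ) EE)).2 h

theorem algind_gen {ι E : Type*} [Field E] [Algebra ℂ E] [DecidableEq ι] (c : ι → ℂ)
    (hc : AlgebraicIndependent ℚ c) (p q : ι) (hne : p ≠ q) (s : E) (hs : Transcendental ℂ s)
    (S : Finset ι) (hp : p ∉ S) (hq : q ∉ S) (α : ι → ℕ) (hα : Function.Injective α) (t : E)
    (ht : t * algebraMap ℂ E (c q) ^ α p =
      - ((∑ n ∈ S, algebraMap ℂ E (c n) * algebraMap ℂ E (c q) ^ α n) +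
        s * algebraMap ℂ E (c q) ^ α q))
    (f : ι → E) (hf : ∀ n, f n = if n = p then t else if n = q then s else algebraMap ℂ E (c n)) :
    Function.Injective (eval₂Hom ((algebraMap ℂ E).comp (algebraMap ℚ ℂ)) f) := by
  let _ : Algebra ℚ E := ((algebraMap ℂ E).comp (algebraMap ℚ ℂ)).toAlgebra
  have : IsScalarTower ℚ ℂ E := IsScalarTower.of_algebraMap_eq' rfl
  have h1 := algind_g (E := E) c hc p q s hs
  have h2 := algind_swap _ h1 p q hne S hp hq α hα t (by
      rw [if_neg hne, if_pos rfl, if_pos rfl, ht]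
      congr 2
      refine Finset.sum_congr rfl fun n hn => ?_
      have h1 : n ≠ q := fun h => hq (h ▸ hn)
      have h2 : n ≠ p := fun h => hp (h ▸ hn)
      rw [if_neg h1, if_neg h2])
  have hfun : Function.update (fun n => if n = q then s else if n = p then algebraMap ℂ E (c q)
      else algebraMap ℂ E (c n)) p t = f := by
    ext n
    rw [hf]
    by_cases hn : n = p
    · subst hn; rw [Function.update_self, if_pos rfl]
    · rw [Function.update_of_ne hn, if_neg hn, if_neg hn]
  rw [hfun] at h2
  exact h2

theorem algind_cE {ι : Type*} [Fintype ι] [DecidableEq ι] (c : ι → ℂ)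
    (hc : AlgebraicIndependent ℚ c) (α : ι → ℕ) (hα : Function.Injective α) (p q : ι) (hne : p ≠ q) :
    Function.Injective (eval₂Hom ((algebraMap ℂ EE).comp (algebraMap ℚ ℂ)) (cE c α (c q) p q)) := by
  have hcq : c q ≠ 0 := hc.ne_zero q
  refine algind_gen c hc p q hne sE transc_sE ((Finset.univ.erase p).erase q) (by simp) (by simp) α hα
    (cE c α (c q) p q p) ?_ _ ?_
  · have := cE_p c α (c q) hcq p q
    simp only [kE_eq, map_pow, map_mul] at this ⊢
    rw [this]
  · intro n
    by_cases hn : n = p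
    · subst hn; rw [if_pos rfl]
    · rw [if_neg hn]
      simp [cE, hn, kE_eq]

theorem eval_monomial_pow {σ R : Type*} [Fintype σ] [CommSemiring R] (a : σ → ℕ) (y : R)
    (n : σ →₀ ℕ) (x : R) : eval (fun l => y ^ a l) (monomial n x) = x * y ^ wt a n := by
  rw [eval_monomial, Finsupp.prod_fintype _ _ (by simp), wt, ← Finset.prod_pow_eq_pow_sum]
  congr 1
  refine Finset.prod_congr rfl fun l _ => ?_
  rw [← pow_mul, mul_comm]
  simp

theorem eval_FE {σ ι : Type*} [Fintype σ] [Fintype ι] [DecidableEq ι] (e : ι → σ →₀ ℕ)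
    (a : σ → ℕ) (c : ι → ℂ) (η : ℂ) (hη : η ≠ 0) (p q : ι) (hne : p ≠ q) :
    eval (fun l => kE η ^ a l) (∑ n, monomial (e n) (cE c (fun n => wt a (e n)) η p q n)) = 0 := by
  rw [map_sum, sum_split hne]
  simp only [eval_monomial_pow]
  rw [← map_pow kE, cE_p c _ η hη p q, cE_q _ _ _ _ _ hne]
  have : ∑ x ∈ (Finset.univ.erase p).erase q, cE c (fun n => wt a (e n)) η p q x * kE η ^ wt a (e x) =
      ∑ x ∈ (Finset.univ.erase p).erase q, kE (c x * η ^ wt a (e x)) :=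
    Finset.sum_congr rfl fun x hx => by rw [cE_of_mem _ _ _ _ _ _ hx, map_mul, map_pow]
  rw [this, ← map_pow kE]
  ring

/-- the restriction to the curve -/
def Theta {σ Ω : Type*} [Field Ω] (a : σ → ℕ) : MvPolynomial σ Ω →+* Polynomial Ω :=
  eval₂Hom Polynomial.C (fun l => Polynomial.X ^ a l)

theorem eval_Theta {σ Ω : Type*} [Field Ω] (a : σ → ℕ) (y : Ω) (A : MvPolynomial σ Ω) :
    Polynomial.eval y (Theta a A) = eval (fun l => y ^ a l) A := by
  rw [Theta, coe_eval₂Hom, ← Polynomial.coe_evalRingHom, hom_eval₂]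
  have h1 : (Polynomial.evalRingHom y).comp Polynomial.C = RingHom.id Ω := by ext; simp
  rw [h1, eval₂_id]
  simp

theorem Theta_monomial {σ Ω : Type*} [Fintype σ] [Field Ω] (a : σ → ℕ) (n : σ →₀ ℕ) (x : Ω) :
    Theta a (monomial n x) = Polynomial.monomial (wt a n) x := by
  rw [Theta, coe_eval₂Hom, eval₂_monomial, Finsupp.prod_fintype _ _ (by simp), wt,
    ← Polynomial.C_mul_X_pow_eq_monomial, ← Finset.prod_pow_eq_pow_sum]
  congr 1
  refine Finset.prod_congr rfl fun l _ => ?_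
  rw [← pow_mul, mul_comm]
  simp

theorem simple_zero {σ ι : Type*} [Fintype σ] [Fintype ι] [DecidableEq ι] (e : ι → σ →₀ ℕ)
    (a : σ → ℕ) (c : ι → ℂ) (η : ℂ) (hη : η ≠ 0) (p q : ι) (hpq : wt a (e p) < wt a (e q))
    {Ω : Type*} [Field Ω] [Algebra EE Ω] (A C : MvPolynomial σ Ω)
    (h : map (algebraMap EE Ω) (∑ n, monomial (e n) (cE c (fun n => wt a (e n)) η p q n)) = A * C)
    (hA : eval (fun l => algebraMap EE Ω (kE η ^ a l)) A = 0) :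
    eval (fun l => algebraMap EE Ω (kE η ^ a l)) C ≠ 0 := by
  intro hC
  have hne : p ≠ q := by rintro rfl; exact lt_irrefl _ hpq
  simp only [map_pow] at hA hC
  rw [← eval_Theta] at hA hC
  set y := algebraMap EE Ω (kE η) with hy
  have h1 := congrArg (fun P => Polynomial.eval y (Polynomial.derivative (Theta a P))) h
  simp only [map_mul, Polynomial.derivative_mul, Polynomial.eval_add, Polynomial.eval_mul, hA, hC,
    mul_zero, zero_mul, add_zero] at h1
  simp only [map_sum, map_monomial, Theta_monomial, Polynomial.derivative_monomial,
    Polynomial.eval_finsetSum, Polynomial.eval_monomial] at h1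
  set α : ι → ℕ := fun n => wt a (e n) with hα
  have h2 : ∑ n, cE c α η p q n * (α n : EE) * kE η ^ α n = 0 := by
    apply (algebraMap EE Ω).injective
    rw [map_zero, map_sum, ← zero_mul y, ← h1, Finset.sum_mul]
    refine Finset.sum_congr rfl fun n _ => ?_
    simp only [map_mul, map_pow, map_natCast, ← hy]
    by_cases h0 : α n = 0
    · have h0' : wt a (e n) = 0 := h0
      simp [h0, h0']
    · have : y ^ α n = y ^ (α n - 1) * y := by
        rw [← pow_succ]; congr 1; omega
      rw [this]
      ring
  rw [sum_split hne, cE_q _ _ _ _ _ hne] at h2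
  have h3 : cE c α η p q p * (α p : EE) * kE η ^ α p = (α p : EE) *
      - ((∑ n ∈ (Finset.univ.erase p).erase q, kE (c n * η ^ α n)) + sE * kE (η ^ α q)) := by
    rw [← cE_p c α η hη p q, map_pow]; ring
  have h4 : ∑ x ∈ (Finset.univ.erase p).erase q, cE c α η p q x * (α x : EE) * kE η ^ α x =
      ∑ x ∈ (Finset.univ.erase p).erase q, kE (c x * η ^ α x * (α x : ℂ)) :=
    Finset.sum_congr rfl fun x hx => by
      rw [cE_of_mem _ _ _ _ _ _ hx, map_mul, map_mul, map_pow, map_natCast]; ring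
  rw [h3, h4, ← map_sum, ← map_sum, ← map_pow, ← map_natCast kE, ← map_natCast kE] at h2
  obtain ⟨Z, hZ⟩ : ∃ Z : ℂ, Z = (∑ x ∈ (Finset.univ.erase p).erase q, c x * η ^ α x * (α x : ℂ)) -
    (α p : ℂ) * ∑ x ∈ (Finset.univ.erase p).erase q, c x * η ^ α x := ⟨_, rfl⟩
  obtain ⟨w, hw⟩ : ∃ w : ℂ, w = ((α q : ℂ) - (α p : ℂ)) * η ^ α q := ⟨_, rfl⟩
  have hw0 : w ≠ 0 := by
    rw [hw]
    refine mul_ne_zero ?_ (pow_ne_zero _ hη)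
    rw [sub_ne_zero]
    exact_mod_cast hpq.ne'
  have h5 : algebraMap (Polynomial ℂ) EE (Polynomial.C Z + Polynomial.X * Polynomial.C w) = 0 := by
    have : algebraMap (Polynomial ℂ) EE (Polynomial.C Z + Polynomial.X * Polynomial.C w) =
      kE Z + sE * kE w := by rw [map_add, map_mul]; rfl
    rw [this, hZ, hw, ← h2]
    simp only [map_sub, map_mul]
    ring
  rw [IsFractionRing.to_map_eq_zero_iff] at h5
  have h6 := congrArg (fun P => Polynomial.coeff P 1) h5
  simp [Polynomial.coeff_C] at h6
  exact hw0 h6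

theorem transfer {σ R K Ω : Type*} [CommRing R] [IsDomain R] [Field K] [Field Ω] [IsAlgClosed Ω]
    (f : R →+* K) (hf : Function.Injective f) (g : R →+* Ω) (hg : Function.Injective g)
    (G : MvPolynomial σ R)
    (hΩ : ∀ A B : MvPolynomial σ Ω, map g G = A * B → Mono A ∨ Mono B)
    (A B : MvPolynomial σ K) (h : map f G = A * B) : Mono A ∨ Mono B := by
  by_contra hcon
  push Not at hcon
  let f' : FractionRing R →+* K := IsFractionRing.lift hf
  let g' : FractionRing R →+* Ω := IsFractionRing.lift hg
  have hf' : f'.comp (algebraMap R (FractionRing R)) = f := by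
    ext x; simp [f']
  have hg' : g'.comp (algebraMap R (FractionRing R)) = g := by
    ext x; simp [g']
  let _ : Algebra (FractionRing R) K := f'.toAlgebra
  let _ : Algebra (FractionRing R) Ω := g'.toAlgebra
  obtain ⟨A', B', h1, h2, h3⟩ := descent (map (algebraMap R (FractionRing R)) G) A B
    (Ω := Ω) (by
      rw [← h, map_map]
      exact congrArg (fun φ => map φ G) hf') hcon.1 hcon.2
  have h4 : map g G = A' * B' := by
    rw [← h1, map_map]
    exact congrArg (fun φ => map φ G) hg'.symm
  rcases hΩ A' B' h4 with h | h
  · exact h2 h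
  · exact h3 h

theorem main_alg_lt {σ ι : Type*} [Fintype σ] [Fintype ι] [DecidableEq ι] (e : ι → σ →₀ ℕ)
    (M : σ → ℕ) (hM : ∀ n l, e n l ≤ M l)
    (a : σ → ℕ) (b : σ → ℤ)
    (hinj : ∀ m n : σ →₀ ℕ, (∀ l, m l ≤ M l) → (∀ l, n l ≤ M l) → wt a m = wt a n → m = n)
    (he : Function.Injective e)
    (c : ι → ℂ) (hc : AlgebraicIndependent ℚ c) (p q r : ι) (hpq : wt a (e p) < wt a (e q))
    (hb : wt b (e p) = wt b (e q)) (hbr : wt b (e r) ≠ wt b (e p))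
    (A B : MvPolynomial σ ℂ) (h : ∑ n, monomial (e n) (c n) = A * B) : Mono A ∨ Mono B := by
  have hne : p ≠ q := by rintro rfl; exact lt_irrefl _ hpq
  have hcq : c q ≠ 0 := hc.ne_zero q
  have hα : Function.Injective (fun n => wt a (e n)) :=
    fun m n hmn => he (hinj _ _ (hM m) (hM n) hmn)
  have hEg := algind_cE c hc (fun n => wt a (e n)) hα p q hne
  have : CharZero EE := charZero_of_injective_algebraMap (algebraMap ℂ EE).injective
  have hgal : IsGalois EE (AlgebraicClosure EE) := inferInstance
  have htr : Transcendental (IntermediateField.adjoin ℚ (c '' ({p, q}ᶜ : Set ι))) (c q) := by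
    rw [IntermediateField.transcendental_adjoin_iff]
    exact hc.transcendental_adjoin (by simp)
  have hE : ∀ A R : MvPolynomial σ EE,
      ∑ n, monomial (e n) (cE c (fun n => wt a (e n)) (c q) p q n) = A * R → Mono A ∨ Mono R :=
    fun A R h => H_step e M hM a b hinj he c (c q) p q r hpq hb hbr (hc.ne_zero r) _
      (fun n h1 h2 => IntermediateField.subset_adjoin ℚ (c '' ({p, q}ᶜ : Set ι))
        (Set.mem_image_of_mem c (by simp [h1, h2]))) htr A R h
  have hΩ : ∀ A B : MvPolynomial σ (AlgebraicClosure EE),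
      map (algebraMap EE (AlgebraicClosure EE))
        (∑ n, monomial (e n) (cE c (fun n => wt a (e n)) (c q) p q n)) = A * B → Mono A ∨ Mono B :=
    fun A B h => galois_step _ (fun l => kE (c q) ^ a l)
      (fun l => pow_ne_zero _ ((map_ne_zero kE).2 hcq)) (eval_FE e a c (c q) hcq p q hne)
      (fun A C h => simple_zero e a c (c q) hcq p q hpq A C h) hE A B h
  refine transfer (R := MvPolynomial ι ℚ) (Ω := AlgebraicClosure EE)
    (aeval c : MvPolynomial ι ℚ →ₐ[ℚ] ℂ).toRingHom hc
    ((algebraMap EE (AlgebraicClosure EE)).comp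
      (eval₂Hom ((algebraMap ℂ EE).comp (algebraMap ℚ ℂ)) (cE c (fun n => wt a (e n)) (c q) p q)))
    ((algebraMap EE (AlgebraicClosure EE)).injective.comp hEg)
    (∑ n, monomial (e n) (X n)) ?_ A B ?_
  · intro A B h
    apply hΩ
    rw [← h, ← map_map]
    congr 1
    simp only [map_sum, map_monomial, coe_eval₂Hom, eval₂_X]
  · rw [← h]
    simp [map_sum, map_monomial]

theorem main_alg {σ ι : Type*} [Fintype σ] [Fintype ι] [DecidableEq ι] (e : ι → σ →₀ ℕ)
    (M : σ → ℕ) (hM : ∀ n l, e n l ≤ M l)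
    (a : σ → ℕ) (b : σ → ℤ)
    (hinj : ∀ m n : σ →₀ ℕ, (∀ l, m l ≤ M l) → (∀ l, n l ≤ M l) → wt a m = wt a n → m = n)
    (he : Function.Injective e)
    (c : ι → ℂ) (hc : AlgebraicIndependent ℚ c) (p q r : ι) (hpq : p ≠ q)
    (hb : wt b (e p) = wt b (e q)) (hbr : wt b (e r) ≠ wt b (e p))
    (A B : MvPolynomial σ ℂ) (h : ∑ n, monomial (e n) (c n) = A * B) : Mono A ∨ Mono B := by
  have hne : wt a (e p) ≠ wt a (e q) := fun h => hpq (he (hinj _ _ (hM p) (hM q) h))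
  rcases lt_or_gt_of_ne hne with h1 | h1
  · exact main_alg_lt e M hM a b hinj he c hc p q r h1 hb hbr A B h
  · exact main_alg_lt e M hM a b hinj he c hc q p r h1 hb.symm (fun h => hbr (h.trans hb.symm)) A B h

theorem exists_kronecker {d : ℕ} (M : Fin d → ℕ) : ∃ a : Fin d → ℕ,
    ∀ m n : Fin d →₀ ℕ, (∀ l, m l ≤ M l) → (∀ l, n l ≤ M l) → wt a m = wt a n → m = n := by
  set N := (∑ l, M l) + 1 with hN
  refine ⟨fun l => N ^ (l : ℕ), fun m n hm hn h => ?_⟩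
  have hlt : ∀ l, M l < N := fun l =>
    Nat.lt_succ_of_le (Finset.single_le_sum (f := M) (fun _ _ => Nat.zero_le _) (Finset.mem_univ l))
  let f : Fin d → Fin N := fun l => ⟨m l, (hm l).trans_lt (hlt l)⟩
  let g : Fin d → Fin N := fun l => ⟨n l, (hn l).trans_lt (hlt l)⟩
  have hfg : finFunctionFinEquiv f = finFunctionFinEquiv g := by
    apply Fin.ext
    rw [finFunctionFinEquiv_apply, finFunctionFinEquiv_apply]
    exact h
  have := finFunctionFinEquiv.injective hfg
  ext l
  exact congrArg Fin.val (congrFun this l)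

theorem wt_b {d : ℕ} (i j : Fin d) (ui uj : ℤ) (n : Fin d →₀ ℕ) :
    wt (fun l => (if l = j then ui else 0) - (if l = i then uj else 0)) n = n j * ui - n i * uj := by
  simp [wt, mul_sub, Finset.sum_sub_distrib]

theorem exists_pqr {d : ℕ} {ι : Type*} (e : ι → Fin d →₀ ℕ)
    (hrank : ¬ ∃ (a v : Fin d → ℝ), ∀ m : ι, ∃ t : ℝ, ∀ i, ((e m i : ℕ) : ℝ) = a i + t * v i) :
    ∃ (p q r : ι) (b : Fin d → ℤ), p ≠ q ∧ wt b (e p) = wt b (e q) ∧ wt b (e r) ≠ wt b (e p) := by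
  push Not at hrank
  obtain ⟨p, -⟩ := hrank 0 0
  obtain ⟨q, hq⟩ := hrank (fun i => e p i) 0
  obtain ⟨i, hi⟩ := hq 0
  simp at hi
  obtain ⟨r, hr⟩ := hrank (fun i => e p i) (fun i => (e q i : ℝ) - e p i)
  have hu : (e q i : ℝ) - e p i ≠ 0 := by
    rw [sub_ne_zero]; exact_mod_cast hi
  obtain ⟨j, hj⟩ := hr (((e r i : ℝ) - e p i) / ((e q i : ℝ) - e p i))
  refine ⟨p, q, r, fun l => (if l = j then ((e q i : ℤ) - e p i) else 0) -
    (if l = i then ((e q j : ℤ) - e p j) else 0), ?_, ?_, ?_⟩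
  · rintro rfl; exact hi rfl
  · rw [wt_b, wt_b]; ring
  · rw [wt_b, wt_b]
    intro h
    apply hj
    have h' : (e r j : ℝ) * (e q i - e p i) - e r i * (e q j - e p j) =
        e p j * (e q i - e p i) - e p i * (e q j - e p j) := by exact_mod_cast h
    field_simp
    linarith

theorem countable_exp (w : ℂ) : {t : ℝ | Complex.exp (Complex.I * (t : ℂ)) = w}.Countable := by
  by_cases h : ∃ t0 : ℝ, Complex.exp (Complex.I * (t0 : ℂ)) = w
  · obtain ⟨t0, h0⟩ := h
    refine (Set.countable_range (fun n : ℤ => t0 + n * (2 * Real.pi))).mono ?_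
    intro t ht
    have ht' : Complex.exp (Complex.I * (t : ℂ)) = w := ht
    rw [← h0, Complex.exp_eq_exp_iff_exists_int] at ht'
    obtain ⟨n, hn⟩ := ht'
    refine ⟨n, ?_⟩
    have h2 : Complex.I * (t : ℂ) = Complex.I * ((t0 + n * (2 * Real.pi) : ℝ) : ℂ) := by
      rw [hn]; push_cast; ring
    have h3 := mul_left_cancel₀ Complex.I_ne_zero h2
    exact (Complex.ofReal_injective h3).symm
  · convert Set.countable_empty
    ext t
    simp only [Set.mem_ofPred_eq, Set.mem_empty_iff_false, iff_false]
    exact fun ht => h ⟨t, ht⟩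

theorem cont_eval {ι : Type*} (P : MvPolynomial ι ℂ) :
    Continuous (fun φ : ι → ℝ => eval (fun m => Complex.exp (Complex.I * (φ m : ℂ))) P) := by
  apply MvPolynomial.continuous_eval P |>.comp
  fun_prop

theorem null_fin : ∀ (n : ℕ) (ν : Fin n → Measure ℝ) (_ : ∀ i, IsProbabilityMeasure (ν i))
    (_ : ∀ i, NoAtoms (ν i)) (P : MvPolynomial (Fin n) ℂ) (_ : P ≠ 0),
    ∀ᵐ φ ∂Measure.pi ν, eval (fun m => Complex.exp (Complex.I * (φ m : ℂ))) P ≠ 0 := by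
  intro n
  induction n with
  | zero =>
    intro ν _ _ P hP
    refine Filter.Eventually.of_forall fun φ h => hP ?_
    rw [MvPolynomial.eq_C_of_isEmpty P] at h ⊢
    rw [eval_C] at h
    rw [h, C_0]
  | succ n ih =>
    intro ν h1 h2 P hP
    have mp := measurePreserving_piFinSuccAbove ν 0
    set Z : Set (ℝ × (Fin n → ℝ)) :=
      {x | eval (fun m => Complex.exp (Complex.I * ((Fin.cons x.1 x.2 : Fin (n+1) → ℝ) m : ℂ))) P = 0} with hZ
    have hcont : Continuous (fun x : ℝ × (Fin n → ℝ) => (Fin.cons x.1 x.2 : Fin (n+1) → ℝ)) := by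
      fun_prop
    have hZm : MeasurableSet Z := by
      apply IsClosed.measurableSet
      exact isClosed_eq ((cont_eval P).comp hcont) continuous_const
    have hZ0 : ((ν 0).prod (Measure.pi fun j => ν ((0 : Fin (n + 1)).succAbove j))) Z = 0 := by
      rw [Measure.measure_prod_null hZm]
      set Q := finSuccEquiv ℂ n P with hQ
      have hQ0 : Q ≠ 0 := by
        rw [hQ]; simpa using hP
      have hcount : {t : ℝ | Polynomial.eval (C (Complex.exp (Complex.I * (t : ℂ)))) Q = 0}.Countable := by
        have : {t : ℝ | Polynomial.eval (C (Complex.exp (Complex.I * (t : ℂ)))) Q = 0} ⊆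
            ⋃ w ∈ {w : ℂ | Polynomial.eval (C w) Q = 0}, {t : ℝ | Complex.exp (Complex.I * (t : ℂ)) = w} := by
          intro t ht
          simp only [Set.mem_iUnion]
          exact ⟨_, ht, rfl⟩
        refine Set.Countable.mono this (Set.Countable.biUnion ?_ fun w _ => countable_exp w)
        apply Set.Finite.countable
        have hfin : (Q.rootSet (MvPolynomial (Fin n) ℂ)).Finite := Q.rootSet_finite _
        refine Set.Finite.of_injOn (f := C) (t := {x | Polynomial.eval x Q = 0}) ?_ ?_ ?_
        · intro w hw; exact hw
        · exact (C_injective (Fin n) ℂ).injOn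
        · refine Set.Finite.subset (Q.roots.toFinset.finite_toSet) ?_
          intro x hx
          simp only [Finset.mem_coe, Multiset.mem_toFinset]
          exact (Polynomial.mem_roots hQ0).2 hx
      have hae : ∀ᵐ t : ℝ ∂(ν 0), Polynomial.eval (C (Complex.exp (Complex.I * (t : ℂ)))) Q ≠ 0 := by
        rw [ae_iff]
        simp only [not_not]
        have : NullSingletonClass (ν 0) := h2 0
        exact Set.Countable.measure_zero (α := ℝ) hcount (ν 0)
      filter_upwards [hae] with t ht
      have := ih (fun j => ν ((0 : Fin (n + 1)).succAbove j)) (fun j => h1 _) (fun j => h2 _) _ ht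
      rw [ae_iff] at this
      simp only [not_not] at this
      rw [Pi.zero_apply, ← this]
      congr 1
      ext φ
      simp only [hZ, Set.mem_preimage, Set.mem_ofPred_eq]
      have hcons : (fun m => Complex.exp (Complex.I * ((Fin.cons t φ : Fin (n+1) → ℝ) m : ℂ))) =
        Fin.cons (Complex.exp (Complex.I * (t : ℂ))) (fun m => Complex.exp (Complex.I * (φ m : ℂ))) := by
        ext m
        refine Fin.cases ?_ (fun j => ?_) m <;> simp
      rw [hcons, eval_eq_eval_mv_eval', Polynomial.eval_map]
      have h5 := Polynomial.eval₂_at_apply (p := Q)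
        (eval (fun m : Fin n => Complex.exp (Complex.I * (φ m : ℂ)))) (C (Complex.exp (Complex.I * (t : ℂ))))
      rw [eval_C] at h5
      rw [← hQ, h5]
    have h6 := mp.measure_preimage hZm.nullMeasurableSet
    rw [hZ0] at h6
    rw [ae_iff]
    simp only [not_not]
    rw [← h6]
    congr 1
    ext φ
    simp only [hZ, Set.mem_preimage, Set.mem_ofPred_eq]
    have : (Fin.cons ((MeasurableEquiv.piFinSuccAbove (fun _ => ℝ) 0) φ).1
      ((MeasurableEquiv.piFinSuccAbove (fun _ => ℝ) 0) φ).2 : Fin (n+1) → ℝ) = φ := by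
      ext m
      refine Fin.cases ?_ (fun j => ?_) m <;> simp [MeasurableEquiv.piFinSuccAbove, Fin.tail]
    rw [this]

theorem null_fintype {ι : Type*} [Fintype ι] (ν : ι → Measure ℝ)
    (h1 : ∀ i, IsProbabilityMeasure (ν i))
    (h2 : ∀ i, NoAtoms (ν i)) (P : MvPolynomial ι ℂ) (hP : P ≠ 0) :
    ∀ᵐ φ ∂Measure.pi ν, eval (fun m => Complex.exp (Complex.I * (φ m : ℂ))) P ≠ 0 := by
  let f := (Fintype.equivFin ι)
  have mp := measurePreserving_piCongrLeft ν f.symm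
  have h3 := null_fin _ (fun i => ν (f.symm i)) (fun i => h1 _) (fun i => h2 _) (rename f P)
    (by
      intro h
      exact hP (rename_injective f f.injective (by rw [h, map_zero])))
  rw [← mp.map_eq]
  rw [ae_map_iff mp.measurable.aemeasurable]
  · filter_upwards [h3] with φ h
    rw [eval_rename] at h
    convert h using 4 with m
    simp only [Function.comp]
    have := Equiv.piCongrLeft_apply_apply (P := fun _ : ι => ℝ) f.symm φ (f m)
    simp only [Equiv.symm_apply_apply] at this
    rw [← this]
    rfl
  · exact (isClosed_eq (cont_eval P) continuous_const).measurableSet.compl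

theorem ae_algind {ι : Type*} [Fintype ι] (ν : ι → Measure ℝ)
    (h1 : ∀ i, IsProbabilityMeasure (ν i)) (h2 : ∀ i, NoAtoms (ν i)) (x0 : ι → ℂ) :
    ∀ᵐ φ ∂Measure.pi ν, AlgebraicIndependent ℚ
      (fun m : {m // x0 m ≠ 0} => Complex.exp (Complex.I * (φ m : ℂ)) * x0 m) := by
  have hcnt : Countable (MvPolynomial {m // x0 m ≠ 0} ℚ) := by
    rw [← Cardinal.mk_le_aleph0_iff]
    refine MvPolynomial.cardinalMk_le_max_lift.trans ?_
    simp [Cardinal.mk_le_aleph0]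
  simp only [algebraicIndependent_iff]
  rw [ae_all_iff]
  intro p
  by_cases hp : p = 0
  · exact Filter.Eventually.of_forall fun _ _ => hp
  set P : MvPolynomial ι ℂ := aeval (fun m : {m // x0 m ≠ 0} => (X m.1 * C (x0 m) : MvPolynomial ι ℂ)) p
    with hPdef
  have heval : ∀ y : ι → ℂ, eval y P = aeval (fun m : {m // x0 m ≠ 0} => y m * x0 m) p := by
    intro y
    have : (eval y P) = ((aeval y : MvPolynomial ι ℂ →ₐ[ℂ] ℂ).restrictScalars ℚ) P := by
      simp [aeval_eq_eval]
    rw [this, hPdef, ← AlgHom.comp_apply, comp_aeval]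
    simp
  have hP : P ≠ 0 := by
    intro h0
    apply hp
    apply MvPolynomial.map_injective (algebraMap ℚ ℂ) (algebraMap ℚ ℂ).injective
    rw [map_zero]
    apply MvPolynomial.funext
    intro z
    rw [map_zero, eval_map, ← aeval_def]
    have := heval (fun m => if h : x0 m ≠ 0 then z ⟨m, h⟩ / x0 m else 0)
    rw [h0, map_zero] at this
    refine Eq.trans ?_ this.symm
    congr 2
    ext m
    rw [dif_pos m.2, div_mul_cancel₀ _ m.2]
  filter_upwards [null_fintype ν h1 h2 P hP] with φ hφ h
  rw [heval] at hφ
  exact absurd h hφ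

end Irr

/-- For a rank ≥ 2 object and a random phase mask with independent atomless phases,
almost surely the z-transform of the masked object is irreducible up to a monomial
factor. -/
theorem stmt13 (d : ℕ) (hd : 2 ≤ d) (M : Fin d → ℕ)
    (x0 : ((i : Fin d) → Fin (M i + 1)) → ℂ)
    (hrank : ¬ ∃ (a v : Fin d → ℝ), ∀ m : (i : Fin d) → Fin (M i + 1),
      x0 m ≠ 0 → ∃ t : ℝ, ∀ i, ((m i : ℕ) : ℝ) = a i + t * v i)
    (ν : ((i : Fin d) → Fin (M i + 1)) → Measure ℝ)
    (hprob : ∀ m, IsProbabilityMeasure (ν m))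
    (hatomless : ∀ m, NoAtoms (ν m)) :
    ∀ᵐ φ ∂Measure.pi ν,
      ∃ (n0 : Fin d →₀ ℕ) (P : MvPolynomial (Fin d) ℂ),
        Irreducible P ∧ ztransform M x0 φ = MvPolynomial.monomial n0 1 * P := by
  have hae := Irr.ae_algind ν hprob hatomless x0
  let e : {m // x0 m ≠ 0} → Fin d →₀ ℕ :=
    fun m => Finsupp.equivFunOnFinite.symm fun i => (m.1 i : ℕ)
  have he : Function.Injective e := by
    intro m n h
    apply Subtype.ext
    funext i
    apply Fin.ext
    exact DFunLike.congr_fun h i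
  obtain ⟨a, hinj⟩ := Irr.exists_kronecker M
  obtain ⟨p, q, r, b, hpq, hb, hbr⟩ := Irr.exists_pqr e (by
    rintro ⟨a, v, h⟩
    exact hrank ⟨a, v, fun m hm => h ⟨m, hm⟩⟩)
  have hM : ∀ n l, e n l ≤ M l := fun n l => Nat.lt_succ_iff.1 (n.1 l).2
  classical
  filter_upwards [hae] with φ hc
  have hF : ztransform M x0 φ = ∑ n : {m // x0 m ≠ 0}, monomial (e n)
      (Complex.exp (Complex.I * (φ n : ℂ)) * x0 n) := by
    rw [ztransform]
    rw [← Finset.sum_subtype (Finset.univ.filter fun m => x0 m ≠ 0) (by simp)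
      (fun m => monomial (Finsupp.equivFunOnFinite.symm fun i => (m i : ℕ))
        (Complex.exp (Complex.I * (φ m : ℂ)) * x0 m))]
    rw [Finset.sum_filter]
    refine Finset.sum_congr rfl fun m _ => ?_
    by_cases h : x0 m = 0 <;> simp [h]
  have hcoef : ∀ n : {m // x0 m ≠ 0}, coeff (e n) (ztransform M x0 φ) ≠ 0 := by
    intro n
    rw [hF, coeff_sum, Finset.sum_eq_single n]
    · rw [coeff_monomial, if_pos rfl]
      exact hc.ne_zero n
    · intro m _ hm
      rw [coeff_monomial, if_neg (fun h => hm (he h))]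
    · simp
  refine Irr.final_assembly (Irr.not_mono_of (fun h => hpq (he h)) (hcoef p) (hcoef q)) ?_
  intro A B hAB
  rw [hF] at hAB
  exact Irr.main_alg e M hM a b hinj he _ hc p q r hpq hb hbr A B hAB
end
end
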